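/- Let V₁ and V₂ be finite dimensional complex vector spaces and ν a partition of length at most dim V₁ + dim V₂. As a representation of GL(V₁) × GL(V₂) acting on V₁ ⊕ V₂ componentwise, the Schur module S^ν(V₁ ⊕ V₂) decomposes as ⊕_{λ,μ} (S^λ V₁ ⊗ S^μ V₂)^{⊕ c_{λ,μ}^ν}, where c_{λ,μ}^ν are the Littlewood–Richardson coefficients. -/

import Mathlib

open scoped BigOperators
open scoped Classical

/-- A partition: a finitely supported antitone sequence of natural numbers
(the parts, indexed from 0). -/
def IsPartitionFun (f : ℕ →₀ ℕ) : Prop := ∀ ⦃i j : ℕ⦄, i ≤ j → f j ≤ f i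

def Partition' : Type := {f : ℕ →₀ ℕ // IsPartitionFun f}

namespace Partition'

/-- The size `|λ|` of a partition. -/
def size (l : Partition') : ℕ := l.1.sum fun _ v => v

/-- The number of (nonzero) parts of a partition. -/
def plength (l : Partition') : ℕ := l.1.support.card

noncomputable instance : Add Partition' :=
  ⟨fun l m => ⟨l.1 + m.1, fun i j h => by
    simp only [Finsupp.add_apply]
    exact add_le_add (l.2 h) (m.2 h)⟩⟩

noncomputable instance : SMul ℕ Partition' :=
  ⟨fun d l => ⟨d • l.1, fun i j h => by
    simp only [Finsupp.smul_apply, smul_eq_mul]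
    exact Nat.mul_le_mul_left d (l.2 h)⟩⟩

/-- The one-row partition `(m)`. For `m = 0` this is the empty partition. -/
noncomputable def row (m : ℕ) : Partition' :=
  ⟨Finsupp.single 0 m, by
    intro i j h
    simp only [Finsupp.single_apply]
    split_ifs <;> omega⟩

/-- The two-row partition `(a, b)` (with `b ≤ a`). -/
noncomputable def twoRow (a b : ℕ) (hba : b ≤ a) : Partition' :=
  ⟨Finsupp.single 0 a + Finsupp.single 1 b, by
    intro i j h
    simp only [Finsupp.add_apply, Finsupp.single_apply]
    split_ifs <;> omega⟩

/-- `youngCount n a g` is the number of fixed points of the permutation `g` acting on the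
set of functions `Fin n → Fin n` whose fibre over `i` has exactly `a i` elements; i.e. the
value at `g` of the permutation character of `S_n` acting on cosets of the Young subgroup
attached to the composition `a`. It is `0` if some `a i` is negative. -/
noncomputable def youngCount (n : ℕ) (a : Fin n → ℤ) (g : Equiv.Perm (Fin n)) : ℤ :=
  if ∀ i, 0 ≤ a i then
    (Nat.card {f : Fin n → Fin n //
      f ∘ g = f ∧ ∀ i : Fin n, Nat.card {x : Fin n // f x = i} = (a i).toNat} : ℤ)
  else 0

/-- The irreducible character of the symmetric group `S_n` attached to a partition `l`
of `n`, given by the Jacobi–Trudi determinantal formula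
`χ_l = det (h_{l_i - i + j})` expanded over permutations, where `h`-products are the
permutation characters of Young subgroups. (When `size l ≠ n` this is not used.) -/
noncomputable def irrChar (n : ℕ) (l : Partition') (g : Equiv.Perm (Fin n)) : ℤ :=
  ∑ σ : Equiv.Perm (Fin n), (Equiv.Perm.sign σ : ℤ) *
    youngCount n (fun i => (l.1 i : ℤ) + ((σ i : ℕ) : ℤ) - (i : ℤ)) g

/-- The Kronecker coefficient `g_{λ,μ,ν}`: the multiplicity of the irreducible `S_n`-module
`M_ν` in `M_λ ⊗ M_μ` (for `|λ| = |μ| = |ν| = n`), computed as the scalar product of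
characters `(1/n!) ∑_{g ∈ S_n} χ_λ(g) χ_μ(g) χ_ν(g)`; it is `0` if the sizes differ. -/
noncomputable def kron (l m nu : Partition') : ℕ :=
  if size l = size nu ∧ size m = size nu then
    ((∑ g : Equiv.Perm (Fin (size nu)),
        irrChar (size nu) l g * irrChar (size nu) m g * irrChar (size nu) nu g) /
      (Nat.factorial (size nu) : ℤ)).toNat
  else 0

/-- The standard embedding `S_a × S_b ↪ S_{a+b}`. -/
def sumEmb {a b : ℕ} (g : Equiv.Perm (Fin a)) (h : Equiv.Perm (Fin b)) :
    Equiv.Perm (Fin (a + b)) :=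
  (Equiv.permCongr finSumFinEquiv) (Equiv.sumCongr g h)

/-- The Littlewood–Richardson coefficient `c_{λ,μ}^ν`: the multiplicity of `M_ν` in the
induction of `M_λ ⊠ M_μ` from `S_{|λ|} × S_{|μ|}` to `S_{|λ|+|μ|}`, computed by
Frobenius reciprocity as a scalar product of characters; it is `0` unless
`|ν| = |λ| + |μ|`. -/
noncomputable def lr (l m nu : Partition') : ℕ :=
  if size nu = size l + size m then
    ((∑ g : Equiv.Perm (Fin (size l)), ∑ h : Equiv.Perm (Fin (size m)),
        irrChar (size l) l g * irrChar (size m) m h *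
          irrChar (size l + size m) nu (sumEmb g h)) /
      ((Nat.factorial (size l) : ℤ) * (Nat.factorial (size m) : ℤ))).toNat
  else 0

/-- The Aguiar coefficient `a_{λ,μ}^ν`, defined by
`a_{λ,μ}^ν = Σ_{α,β,δ,η,ρ,τ} c_{α,β}^λ c_{η,ρ}^μ g_{β,η,δ} c_{α,δ}^τ c_{τ,ρ}^ν`. -/
noncomputable def aguiar (l m nu : Partition') : ℕ :=
  ∑ᶠ (α : Partition') (β : Partition') (δ : Partition') (η : Partition')
    (ρ : Partition') (τ : Partition'),
    lr α β l * lr η ρ m * kron β η δ * lr α δ τ * lr τ ρ nu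

end Partition'

open scoped TensorProduct DirectSum

namespace Partition'

/-- `partialSum l i` is the number of boxes in the first `i` rows of the Young diagram
of `l`. -/
noncomputable def partialSum (l : Partition') (i : ℕ) : ℕ := ∑ j ∈ Finset.range i, l.1 j

/-- The row containing the `t`-th box of the Young diagram of `l`, the boxes being numbered
`0, 1, …, |l| - 1` row by row (this is the canonical filling). -/
noncomputable def rowOf (l : Partition') (t : ℕ) : ℕ :=
  Nat.findGreatest (fun r => partialSum l r ≤ t) t

/-- The column containing the `t`-th box of the Young diagram of `l`. -/
noncomputable def colOf (l : Partition') (t : ℕ) : ℕ := t - partialSum l (rowOf l t)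

variable (R : Type*) [CommRing R]

/-- The action of a permutation `σ ∈ S_n` on the `n`-th tensor power of `M`, permuting
the tensor factors. -/
noncomputable def permAction (n : ℕ) (M : Type*) [AddCommGroup M] [Module R M]
    (σ : Equiv.Perm (Fin n)) :
    PiTensorProduct R (fun _ : Fin n => M) →ₗ[R] PiTensorProduct R (fun _ : Fin n => M) :=
  (PiTensorProduct.reindex R (fun _ : Fin n => M) σ).toLinearMap

/-- The Young symmetrizer of the canonical tableau of shape `l` (of size `n = |l|`),
acting on the `n`-th tensor power of `M`: the sum over the column group of the signed
permutation action, composed with the sum over the row group of the permutation action. -/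
noncomputable def youngSymmetrizer (l : Partition') (M : Type*) [AddCommGroup M]
    [Module R M] :
    PiTensorProduct R (fun _ : Fin (size l) => M) →ₗ[R]
      PiTensorProduct R (fun _ : Fin (size l) => M) :=
  (∑ σ ∈ Finset.univ.filter
      (fun σ : Equiv.Perm (Fin (size l)) =>
        ∀ t : Fin (size l), colOf l ((σ t : ℕ)) = colOf l (t : ℕ)),
      ((Equiv.Perm.sign σ : ℤ) : R) • permAction R (size l) M σ) ∘ₗ
    (∑ σ ∈ Finset.univ.filter
      (fun σ : Equiv.Perm (Fin (size l)) =>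
        ∀ t : Fin (size l), rowOf l ((σ t : ℕ)) = rowOf l (t : ℕ)),
      permAction R (size l) M σ)

/-- The Schur module `S^l M`: the image of the Young symmetrizer of shape `l` acting on
the `|l|`-th tensor power of `M`. -/
noncomputable def schur (l : Partition') (M : Type*) [AddCommGroup M] [Module R M] :
    Submodule R (PiTensorProduct R (fun _ : Fin (size l) => M)) :=
  LinearMap.range (youngSymmetrizer R l M)

/-- The action of an endomorphism `g` of `M` on the `n`-th tensor power of `M`. -/
noncomputable def tpow (n : ℕ) {M : Type*} [AddCommGroup M] [Module R M] (g : M →ₗ[R] M) :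
    PiTensorProduct R (fun _ : Fin n => M) →ₗ[R] PiTensorProduct R (fun _ : Fin n => M) :=
  PiTensorProduct.map (fun _ => g)

end Partition'


namespace Partition'

lemma partialSum_succ (l : Partition') (r : ℕ) :
    partialSum l (r + 1) = partialSum l r + l.1 r := by
  simp [partialSum, Finset.sum_range_succ]

lemma partialSum_mono (l : Partition') : Monotone (partialSum l) :=
  monotone_nat_of_le_succ fun r => by rw [partialSum_succ]; omega

lemma partialSum_eq_size (l : Partition') (r : ℕ) (h : l.1 r = 0) :
    partialSum l r = size l := by
  unfold partialSum size Finsupp.sum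
  symm
  apply Finset.sum_subset
  · intro i hi
    rw [Finset.mem_range]
    by_contra hlt
    have := l.2 (not_lt.mp hlt)
    rw [Finsupp.mem_support_iff] at hi
    omega
  · intro i _ hi
    simpa using hi

lemma le_partialSum (l : Partition') (r : ℕ) (h : l.1 r ≠ 0) : r ≤ partialSum l r := by
  unfold partialSum
  calc r = ∑ j ∈ Finset.range r, 1 := by simp
    _ ≤ _ := Finset.sum_le_sum fun i hi => by
      have := l.2 (Finset.mem_range.mp hi).le
      omega

lemma partialSum_le_size (l : Partition') (r : ℕ) : partialSum l r ≤ size l := by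
  by_cases h : l.1 r = 0
  · exact (partialSum_eq_size l r h).le
  · by_contra hlt
    have h2 : l.1 (size l + r + 1) = 0 := by
      by_contra h3
      have h4 := le_partialSum l _ h3
      have h5 : ∃ N, r ≤ N ∧ l.1 N = 0 := by
        refine ⟨l.1.support.sup id + r + 1, by omega, ?_⟩
        by_contra h6
        have := Finset.le_sup (f := id) (Finsupp.mem_support_iff.mpr h6)
        simp only [id] at this
        omega
      obtain ⟨N, hN, hN0⟩ := h5
      have := partialSum_mono l hN
      rw [partialSum_eq_size l N hN0] at this
      omega
    have := partialSum_mono l (show r ≤ size l + r + 1 by omega)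
    rw [partialSum_eq_size l _ h2] at this
    omega

lemma eq_zero_of_size_le (l : Partition') (r : ℕ) (h : size l ≤ r) : l.1 r = 0 := by
  by_contra h0
  have h1 := le_partialSum l r h0
  have h2 := partialSum_le_size l (r + 1)
  rw [partialSum_succ] at h2
  omega

lemma sum_range_eq_size (l : Partition') : ∑ j ∈ Finset.range (size l), l.1 j = size l :=
  partialSum_eq_size l _ (eq_zero_of_size_le l _ le_rfl)

lemma rowOf_le (l : Partition') (t : ℕ) : rowOf l t ≤ t := Nat.findGreatest_le t

lemma rowOf_spec (l : Partition') (t : ℕ) (ht : t < size l) :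
    partialSum l (rowOf l t) ≤ t ∧ t < partialSum l (rowOf l t + 1) := by
  constructor
  · exact Nat.findGreatest_spec (P := fun r => partialSum l r ≤ t) (Nat.zero_le t)
      (by simp [partialSum])
  · by_contra h
    rw [not_lt] at h
    by_cases h1 : rowOf l t + 1 ≤ t
    · exact Nat.findGreatest_is_greatest (P := fun r => partialSum l r ≤ t)
        (Nat.lt_succ_self _) h1 h
    · by_cases h2 : l.1 (rowOf l t + 1) = 0
      · rw [partialSum_eq_size l _ h2] at h
        omega
      · have := le_partialSum l _ h2
        omega

lemma rowOf_eq (l : Partition') (t r : ℕ) (ht : t < size l) (h1 : partialSum l r ≤ t)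
    (h2 : t < partialSum l (r + 1)) : rowOf l t = r := by
  obtain ⟨h3, h4⟩ := rowOf_spec l t ht
  rcases lt_trichotomy (rowOf l t) r with h | h | h
  · have := partialSum_mono l (Nat.succ_le_of_lt h)
    simp only [Nat.succ_eq_add_one] at this
    omega
  · exact h
  · have := partialSum_mono l (Nat.succ_le_of_lt h)
    simp only [Nat.succ_eq_add_one] at this
    omega

lemma box_inj (l : Partition') (s t : ℕ) (hs : s < size l) (ht : t < size l)
    (hr : rowOf l s = rowOf l t) (hc : colOf l s = colOf l t) : s = t := by
  have h1 := rowOf_spec l s hs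
  have h2 := rowOf_spec l t ht
  unfold colOf at hc
  rw [hr] at h1 hc
  omega

lemma box_exists (l : Partition') (r c : ℕ) (h : c < l.1 r) :
    ∃ t, t < size l ∧ rowOf l t = r ∧ colOf l t = c := by
  have h1 := partialSum_succ l r
  have h2 := partialSum_le_size l (r + 1)
  have h3 : rowOf l (partialSum l r + c) = r :=
    rowOf_eq l _ r (by omega) (by omega) (by omega)
  refine ⟨partialSum l r + c, by omega, h3, ?_⟩
  unfold colOf
  rw [h3]
  omega

lemma colOf_lt (l : Partition') (t : ℕ) (ht : t < size l) : colOf l t < l.1 (rowOf l t) := by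
  have h1 := rowOf_spec l t ht
  rw [partialSum_succ] at h1
  unfold colOf
  omega

lemma card_row (l : Partition') (n : ℕ) (hn : size l = n) (r : ℕ) :
    (Finset.univ.filter fun t : Fin n => rowOf l t = r).card = l.1 r := by
  subst hn
  rw [← Finset.card_range (l.1 r)]
  apply Finset.card_bij (fun (t : Fin (size l)) _ => colOf l t)
  · intro t ht
    rw [Finset.mem_filter] at ht
    rw [Finset.mem_range, ← ht.2]
    exact colOf_lt l t t.2
  · intro s hs t ht h
    rw [Finset.mem_filter] at hs ht
    exact Fin.ext (box_inj l s t s.2 t.2 (hs.2.trans ht.2.symm) h)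
  · intro c hc
    obtain ⟨t, ht, h1, h2⟩ := box_exists l r c (Finset.mem_range.mp hc)
    exact ⟨⟨t, ht⟩, by simp [h1], h2⟩

lemma sum_range_le_aux (S : Finset ℕ) :
    ∑ i ∈ Finset.range S.card, i ≤ ∑ i ∈ S, i ∧
      (∑ i ∈ Finset.range S.card, i = ∑ i ∈ S, i → S = Finset.range S.card) := by
  set m := S.card with hm
  set R := Finset.range m with hR
  have hcard : (S \ R).card = (R \ S).card := by
    apply Finset.card_sdiff_comm
    simp [hR, hm]
  have h1 := Finset.sum_inter_add_sum_sdiff S R (fun i => i)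
  have h2 := Finset.sum_inter_add_sum_sdiff R S (fun i => i)
  rw [Finset.inter_comm] at h2
  have h3 : (S \ R).card * m ≤ ∑ i ∈ S \ R, i := by
    rw [← smul_eq_mul]
    apply Finset.card_nsmul_le_sum
    intro i hi
    simp only [hR, Finset.mem_sdiff, Finset.mem_range] at hi
    omega
  have h4 : ∑ i ∈ R \ S, (i + 1) ≤ (R \ S).card * m := by
    rw [← smul_eq_mul]
    apply Finset.sum_le_card_nsmul
    intro i hi
    simp only [hR, Finset.mem_sdiff, Finset.mem_range] at hi
    omega
  rw [Finset.sum_add_distrib, Finset.sum_const, smul_eq_mul, mul_one] at h4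
  rw [hcard] at h3
  constructor
  · omega
  · intro h
    have h5 : (R \ S).card = 0 := by omega
    rw [h5, Finset.card_eq_zero, Finset.sdiff_eq_empty_iff_subset] at hcard
    exact Finset.eq_of_subset_of_card_le hcard (by simp [hR, hm])

lemma col_image_row (l : Partition') (n : ℕ) (hn : size l = n) (c : ℕ) :
    (Finset.univ.filter fun t : Fin n => colOf l t = c).image (fun t : Fin _ => rowOf l t) =
      Finset.range (Finset.univ.filter fun t : Fin n => colOf l t = c).card := by
  subst hn
  set S := (Finset.univ.filter fun t : Fin (size l) => colOf l t = c) with hS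
  have hc : (S.image (fun t : Fin _ => rowOf l t)).card = S.card := by
    apply Finset.card_image_of_injOn
    intro s hs t ht h
    simp only [hS, Finset.coe_filter, Finset.mem_univ, true_and, Set.mem_ofPred_eq] at hs ht
    exact Fin.ext (box_inj l s t s.2 t.2 h (hs.trans ht.symm))
  rw [← hc]
  have hdown : ∀ a ∈ S.image (fun t : Fin _ => rowOf l t), ∀ b ≤ a,
      b ∈ S.image (fun t : Fin _ => rowOf l t) := by
    intro a ha b hb
    simp only [hS, Finset.mem_image, Finset.mem_filter, Finset.mem_univ, true_and] at ha ⊢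
    obtain ⟨t, ht, rfl⟩ := ha
    have h1 := colOf_lt l t t.2
    have h2 := l.2 hb
    obtain ⟨u, hu, h3, h4⟩ := box_exists l b c (by omega)
    exact ⟨⟨u, hu⟩, h4, h3⟩
  generalize S.image (fun t : Fin _ => rowOf l t) = T at hdown
  apply Finset.eq_of_subset_of_card_le
  · intro a ha
    rw [Finset.mem_range]
    have : Finset.range (a + 1) ⊆ T := fun b hb =>
      hdown a ha b (by rw [Finset.mem_range] at hb; omega)
    have := Finset.card_le_card this
    rw [Finset.card_range] at this
    omega
  · simp

/-- The fundamental combinatorial lemma on fillings injective on columns. -/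
lemma col_inj_filling (l : Partition') (n : ℕ) (hn : size l = n) (f : Fin n → ℕ)
    (hf : ∀ s t : Fin n, colOf l s = colOf l t → f s = f t → s = t) :
    ∑ t : Fin n, rowOf l t ≤ ∑ t, f t ∧
      (∑ t : Fin n, rowOf l t = ∑ t, f t → ∃ q : Equiv.Perm (Fin n),
        (∀ t, colOf l (q t) = colOf l t) ∧ ∀ t, f (q t) = rowOf l t) := by
  set S : ℕ → Finset (Fin n) := fun c => Finset.univ.filter fun t : Fin n => colOf l t = c
    with hS
  set C := (Finset.univ : Finset (Fin n)).image (fun t : Fin n => colOf l t) with hC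
  have hmaps : ∀ t ∈ (Finset.univ : Finset (Fin n)), (colOf l t) ∈ C := fun t ht =>
    Finset.mem_image_of_mem _ ht
  have hfi : ∀ c, Set.InjOn f (S c) := by
    intro c s hs t ht h
    simp only [hS, Finset.coe_filter, Finset.mem_univ, true_and, Set.mem_ofPred_eq] at hs ht
    exact hf s t (hs.trans ht.symm) h
  have hri : ∀ c, Set.InjOn (fun t : Fin n => rowOf l t) (S c) := by
    intro c s hs t ht h
    simp only [hS, Finset.coe_filter, Finset.mem_univ, true_and, Set.mem_ofPred_eq] at hs ht
    exact Fin.ext (box_inj l s t (by omega) (by omega) h (hs.trans ht.symm))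
  have hfs : ∀ c, ∑ t ∈ S c, f t = ∑ i ∈ (S c).image f, i := fun c => by
    rw [Finset.sum_image (hfi c)]
  have hcf : ∀ c, ((S c).image f).card = (S c).card := fun c =>
    Finset.card_image_of_injOn (hfi c)
  have hrs : ∀ c, ∑ t ∈ S c, rowOf l t = ∑ i ∈ Finset.range (S c).card, i := fun c => by
    rw [← col_image_row l n hn c, Finset.sum_image (hri c)]
  have hle : ∀ c ∈ C, ∑ t ∈ S c, rowOf l t ≤ ∑ t ∈ S c, f t := fun c _ => by
    rw [hfs, hrs, ← hcf]
    exact (sum_range_le_aux _).1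
  rw [← Finset.sum_fiberwise_of_maps_to hmaps, ← Finset.sum_fiberwise_of_maps_to hmaps]
  refine ⟨Finset.sum_le_sum hle, fun heq => ?_⟩
  have heq' := (Finset.sum_eq_sum_iff_of_le hle).mp heq
  have hex : ∀ t : Fin n, ∃ s : Fin n, colOf l s = colOf l t ∧ f s = rowOf l t := by
    intro t
    have h1 := heq' (colOf l t) (hmaps t (Finset.mem_univ _))
    rw [hfs, hrs, ← hcf] at h1
    have h2 := (sum_range_le_aux _).2 h1
    rw [hcf] at h2
    have h3 : rowOf l t ∈ (S (colOf l t)).image f := by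
      rw [h2, ← col_image_row l n hn]
      apply Finset.mem_image_of_mem (fun t : Fin n => rowOf l t)
      simp
    simp only [hS, Finset.mem_image, Finset.mem_filter, Finset.mem_univ, true_and] at h3
    exact h3
  choose q hq1 hq2 using hex
  have hinj : Function.Injective q := by
    intro s t h
    refine Fin.ext (box_inj l s t (by omega) (by omega) ?_ ?_)
    · rw [← hq2 s, ← hq2 t, h]
    · rw [← hq1 s, ← hq1 t, h]
  exact ⟨Equiv.ofBijective q (Finite.injective_iff_bijective.mp hinj), hq1, hq2⟩

end Partition'

namespace Partition'

/-- Size of a fibre. -/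
noncomputable def fib {n : ℕ} {J : Type} (f : Fin n → J) (j : J) : ℕ :=
  (Finset.univ.filter fun x => f x = j).card

lemma fib_comp {n : ℕ} {J : Type} (f : Fin n → J) (p : Equiv.Perm (Fin n)) (j : J) :
    fib (f ∘ p) j = fib f j := by
  unfold fib
  apply Finset.card_bij (fun x _ => p x)
  · intro x hx
    simpa using hx
  · intro x _ y _ h
    exact p.injective h
  · intro y hy
    exact ⟨p.symm y, by simpa using hy, by simp⟩

lemma exists_perm_of_fib {n : ℕ} {J : Type} (f g : Fin n → J) (h : ∀ j, fib f j = fib g j) :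
    ∃ p : Equiv.Perm (Fin n), g ∘ p = f := by
  have e : ∀ j, Nonempty ({a // f a = j} ≃ {b // g b = j}) := fun j => by
    apply Fintype.card_eq.mp
    rw [Fintype.card_subtype, Fintype.card_subtype]
    exact h j
  exact ⟨Equiv.ofFiberEquiv fun j => (e j).some, funext fun a => Equiv.ofFiberEquiv_map _ a⟩

lemma sum_fib {n : ℕ} {J : Type} [Fintype J] (f : Fin n → J) : ∑ j, fib f j = n := by
  unfold fib
  have := Finset.card_eq_sum_card_fiberwise (f := f) (s := Finset.univ) (t := Finset.univ)
    (fun _ _ => Finset.mem_coe.mpr (Finset.mem_univ _))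
  rw [Finset.card_univ, Fintype.card_fin] at this
  exact (this.trans (Finset.sum_congr rfl fun j _ => by congr!)).symm

lemma exists_of_fib {n : ℕ} {J : Type} [Fintype J] (m : J → ℕ) (h : ∑ j, m j = n) :
    ∃ f : Fin n → J, ∀ j, fib f j = m j := by
  have e : Nonempty (Fin n ≃ Σ j, Fin (m j)) := by
    apply Fintype.card_eq.mp
    simp [h]
  obtain ⟨e⟩ := e
  refine ⟨fun x => (e x).1, fun j => ?_⟩
  unfold fib
  rw [← Fintype.card_subtype]
  conv_rhs => rw [← Fintype.card_fin (m j)]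
  apply Fintype.card_congr
  exact (e.subtypeEquiv (fun a => Iff.rfl) : {x // (e x).1 = j} ≃ {y : Σ j, Fin (m j) // y.1 = j}).trans
    (Equiv.sigmaFiberEquiv' m j)
where
  Equiv.sigmaFiberEquiv' {J : Type} (m : J → ℕ) (j : J) :
      {y : Σ j, Fin (m j) // y.1 = j} ≃ Fin (m j) :=
    { toFun := fun y => y.2 ▸ y.1.2
      invFun := fun i => ⟨⟨j, i⟩, rfl⟩
      left_inv := by rintro ⟨⟨j', i⟩, rfl⟩; rfl
      right_inv := fun i => rfl }

/-- Orbit counting. -/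
lemma orbit_count {n : ℕ} {J : Type} [Fintype J] (m : J → ℕ) (h : ∑ j, m j = n) :
    ∑ F : Fin n → J, (if ∀ j, fib F j = m j then
      (Finset.univ.filter fun g : Equiv.Perm (Fin n) => F ∘ g = F).card else 0) =
      Nat.factorial n := by
  obtain ⟨F0, hF0⟩ := exists_of_fib m h
  have h1 : Nat.factorial n = ∑ F : Fin n → J,
      (Finset.univ.filter fun p : Equiv.Perm (Fin n) => F0 ∘ p = F).card := by
    rw [← Finset.card_eq_sum_card_fiberwise
      (fun _ _ => Finset.mem_coe.mpr (Finset.mem_univ _))]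
    simp [Fintype.card_perm]
  rw [h1]
  refine Finset.sum_congr rfl fun F _ => ?_
  split_ifs with hF
  · obtain ⟨p0, hp0⟩ := exists_perm_of_fib F F0 (fun j => (hF j).trans (hF0 j).symm)
    apply Finset.card_bij (fun g _ => p0 * g)
    · intro g hg
      rw [Finset.mem_filter] at hg ⊢
      refine ⟨Finset.mem_univ _, ?_⟩
      rw [Equiv.Perm.coe_mul, ← Function.comp_assoc, hp0, hg.2]
    · intro a _ b _ hab
      exact mul_left_cancel hab
    · intro p hp
      rw [Finset.mem_filter] at hp
      refine ⟨p0⁻¹ * p, ?_, by simp⟩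
      rw [Finset.mem_filter]
      refine ⟨Finset.mem_univ _, ?_⟩
      have : p = p0 * (p0⁻¹ * p) := by simp
      rw [this, Equiv.Perm.coe_mul, ← Function.comp_assoc, hp0] at hp
      exact hp.2
  · symm
    rw [Finset.card_eq_zero, Finset.filter_eq_empty_iff]
    intro p _ hp
    apply hF
    intro j
    rw [← hp, fib_comp, hF0]

lemma youngCount_eq (n : ℕ) (a : Fin n → ℤ) (g : Equiv.Perm (Fin n)) :
    youngCount n a g = ∑ f : Fin n → Fin n,
      if (∀ i, (fib f i : ℤ) = a i) ∧ f ∘ g = f then 1 else 0 := by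
  unfold youngCount
  rw [Finset.sum_boole]
  split_ifs with h
  · rw [Nat.card_eq_fintype_card, Fintype.card_subtype]
    congr 2
    ext f
    simp only [Finset.mem_filter, Finset.mem_univ, true_and]
    rw [and_comm]
    apply and_congr_left'
    apply forall_congr'
    intro i
    rw [Nat.card_eq_fintype_card, Fintype.card_subtype]
    have := h i
    have h2 : fib f i = (Finset.univ.filter fun x => f x = i).card := by
      unfold fib
      congr!
    rw [h2]
    omega
  · symm
    rw [Nat.cast_eq_zero, Finset.card_eq_zero, Finset.filter_eq_empty_iff]
    intro f _ hf
    apply h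
    intro i
    rw [← hf.1 i]
    positivity

/-- The number of matrices with given margins. -/
noncomputable def numMat (n : ℕ) (a b : Fin n → ℤ) : ℤ :=
  ∑ M ∈ Finset.piAntidiag (Finset.univ : Finset (Fin n × Fin n)) n,
    if (∀ i, ((∑ j, M (i, j) : ℕ) : ℤ) = a i) ∧ (∀ j, ((∑ i, M (i, j) : ℕ) : ℤ) = b j) then 1 else 0

lemma fib_fst {n : ℕ} (F : Fin n → Fin n × Fin n) (i : Fin n) :
    fib (fun x => (F x).1) i = ∑ j, fib F (i, j) := by
  unfold fib
  rw [Finset.card_eq_sum_card_fiberwise (f := fun x => (F x).2) (t := Finset.univ)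
    (fun _ _ => Finset.mem_coe.mpr (Finset.mem_univ _))]
  refine Finset.sum_congr rfl fun j _ => ?_
  rw [Finset.filter_filter]
  congr 1
  ext x
  simp [Prod.ext_iff]

lemma fib_snd {n : ℕ} (F : Fin n → Fin n × Fin n) (j : Fin n) :
    fib (fun x => (F x).2) j = ∑ i, fib F (i, j) := by
  unfold fib
  rw [Finset.card_eq_sum_card_fiberwise (f := fun x => (F x).1) (t := Finset.univ)
    (fun _ _ => Finset.mem_coe.mpr (Finset.mem_univ _))]
  refine Finset.sum_congr rfl fun i _ => ?_
  rw [Finset.filter_filter]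
  congr 1
  ext x
  simp [Prod.ext_iff, and_comm]

lemma sum_youngCount_mul (n : ℕ) (a b : Fin n → ℤ) :
    ∑ g, youngCount n a g * youngCount n b g = (Nat.factorial n : ℤ) * numMat n a b := by
  have h1 : ∀ g, youngCount n a g * youngCount n b g = ∑ F : Fin n → Fin n × Fin n,
      if ((∀ i, ((∑ j, fib F (i, j) : ℕ) : ℤ) = a i) ∧ (∀ j, ((∑ i, fib F (i, j) : ℕ) : ℤ) = b j))
        then (if F ∘ g = F then (1 : ℤ) else 0) else 0 := by
    intro g
    rw [youngCount_eq, youngCount_eq, Finset.sum_mul_sum, ← Fintype.sum_prod_type',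
      ← (Equiv.arrowProdEquivProdArrow (Fin n) (fun _ => Fin n) (fun _ => Fin n)).sum_comp]
    refine Finset.sum_congr rfl fun F _ => ?_
    simp only [Equiv.arrowProdEquivProdArrow, Equiv.coe_fn_mk, fib_fst, fib_snd]
    have h2 : F ∘ g = F ↔ ((fun x => (F x).1) ∘ g = (fun x => (F x).1)) ∧
        ((fun x => (F x).2) ∘ g = (fun x => (F x).2)) := by
      simp only [funext_iff, Function.comp, Prod.ext_iff, forall_and]
    rw [← ite_and, mul_ite, mul_one, mul_zero, ← ite_and]
    apply if_congr _ rfl rfl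
    rw [h2]
    tauto
  simp_rw [h1]
  rw [Finset.sum_comm]
  have h3 : ∀ F ∈ (Finset.univ : Finset (Fin n → Fin n × Fin n)),
      fib F ∈ Finset.piAntidiag (Finset.univ : Finset (Fin n × Fin n)) n := by
    intro F _
    rw [Finset.mem_piAntidiag]
    exact ⟨sum_fib F, fun _ _ => Finset.mem_univ _⟩
  rw [← Finset.sum_fiberwise_of_maps_to h3, numMat, Finset.mul_sum]
  refine Finset.sum_congr rfl fun M hM => ?_
  rw [Finset.mem_piAntidiag] at hM
  rw [← orbit_count M hM.1]
  push_cast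
  rw [Finset.sum_mul, Finset.sum_filter]
  refine Finset.sum_congr rfl fun F _ => ?_
  have h4 : fib F = M ↔ ∀ j, fib F j = M j := funext_iff
  by_cases h5 : fib F = M
  · subst h5
    by_cases h6 : (∀ (i : Fin n), ∑ x, (fib F (i, x) : ℤ) = a i) ∧ ∀ (j : Fin n), ∑ x, (fib F (x, j) : ℤ) = b j
    · simp [h6]
      congr!
    · simp only [if_neg h6]
      simp
  · rw [if_neg h5, if_neg (fun h => h5 (h4.mpr h))]
    simp

end Partition'

namespace Partition'

section Orthonormality

variable (n : ℕ)

/-- Generating series of the complete homogeneous polynomials. -/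
noncomputable def hser : PowerSeries (MvPolynomial (Fin n) ℤ) :=
  ∏ l : Fin n, PowerSeries.mk (fun k => (MvPolynomial.X l : MvPolynomial (Fin n) ℤ) ^ k)

/-- Complete homogeneous polynomials, extended by zero to negative indices. -/
noncomputable def hhom (p : ℤ) : MvPolynomial (Fin n) ℤ :=
  if 0 ≤ p then PowerSeries.coeff p.toNat (hser n) else 0

lemma hser_coeff (p : ℕ) : PowerSeries.coeff p (hser n) =
    ∑ l ∈ Finset.finsuppAntidiag (Finset.univ : Finset (Fin n)) p, MvPolynomial.monomial l (1 : ℤ) := by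
  rw [hser, PowerSeries.coeff_prod]
  refine Finset.sum_congr rfl fun l _ => ?_
  simp only [PowerSeries.coeff_mk]
  rw [MvPolynomial.monomial_eq]
  simp [Finsupp.prod_fintype]

/-- The product of all but one of the inverse geometric factors. -/
noncomputable def qser (s : Finset (Fin n)) : PowerSeries (MvPolynomial (Fin n) ℤ) :=
  ∏ m ∈ s, (1 - PowerSeries.C (MvPolynomial.X m : MvPolynomial (Fin n) ℤ) * PowerSeries.X)

lemma qser_coeff (s : Finset (Fin n)) : ∀ b, s.card < b → PowerSeries.coeff b (qser n s) = 0 := by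
  induction s using Finset.induction_on with
  | empty =>
    intro b hb
    rw [qser, Finset.prod_empty, PowerSeries.coeff_one, if_neg]
    simp at hb; omega
  | insert a s ha ih =>
    intro b hb
    rw [Finset.card_insert_of_notMem ha] at hb
    obtain ⟨b, rfl⟩ : ∃ b', b = b' + 1 := ⟨b - 1, by omega⟩
    rw [qser, Finset.prod_insert ha, ← qser, sub_mul, one_mul, map_sub, ih _ (by omega), mul_assoc,
      PowerSeries.coeff_C_mul, PowerSeries.coeff_succ_X_mul, ih _ (by omega)]
    simp

lemma geom_mul (m : Fin n) :
    PowerSeries.mk (fun k => (MvPolynomial.X m : MvPolynomial (Fin n) ℤ) ^ k) *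
      (1 - PowerSeries.C (MvPolynomial.X m : MvPolynomial (Fin n) ℤ) * PowerSeries.X) = 1 := by
  ext1 b
  rw [mul_comm, sub_mul, one_mul, map_sub, mul_assoc, PowerSeries.coeff_C_mul]
  cases b with
  | zero => simp
  | succ b =>
    rw [PowerSeries.coeff_succ_X_mul]
    simp [PowerSeries.coeff_one, pow_succ, mul_comm]

lemma hser_mul (l : Fin n) : hser n * qser n (Finset.univ.erase l) =
    PowerSeries.mk (fun k => (MvPolynomial.X l : MvPolynomial (Fin n) ℤ) ^ k) := by
  rw [hser, ← Finset.mul_prod_erase _ _ (Finset.mem_univ l), qser, mul_assoc,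
    ← Finset.prod_mul_distrib, Finset.prod_congr rfl (fun m _ => geom_mul n m)]
  simp

lemma pow_eq_sum (l : Fin n) (p : ℕ) : (MvPolynomial.X l : MvPolynomial (Fin n) ℤ) ^ p =
    ∑ b ∈ Finset.range n, hhom n ((p : ℤ) - b) *
      PowerSeries.coeff b (qser n (Finset.univ.erase l)) := by
  have h := congrArg (PowerSeries.coeff p) (hser_mul n l)
  rw [PowerSeries.coeff_mk, mul_comm, PowerSeries.coeff_mul,
    Finset.Nat.sum_antidiagonal_eq_sum_range_succ_mk] at h
  rw [← h]
  have h1 : ∑ k ∈ Finset.range p.succ, PowerSeries.coeff k (qser n (Finset.univ.erase l)) *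
      PowerSeries.coeff (p - k) (hser n) = ∑ k ∈ Finset.range (p + 1 + n), hhom n ((p : ℤ) - k) *
      PowerSeries.coeff k (qser n (Finset.univ.erase l)) := by
    rw [← Finset.sum_subset (Finset.range_mono (show p + 1 ≤ p + 1 + n by omega))]
    · refine Finset.sum_congr rfl fun k hk => ?_
      rw [Finset.mem_range] at hk
      rw [hhom, if_pos (by omega), mul_comm]
      congr 3
      omega
    · intro k _ hk
      rw [Finset.mem_range] at hk
      rw [hhom, if_neg (by omega), zero_mul]
  have h2 : ∑ b ∈ Finset.range n, hhom n ((p : ℤ) - b) *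
      PowerSeries.coeff b (qser n (Finset.univ.erase l)) =
      ∑ k ∈ Finset.range (p + 1 + n), hhom n ((p : ℤ) - k) *
      PowerSeries.coeff k (qser n (Finset.univ.erase l)) := by
    apply Finset.sum_subset (Finset.range_mono (show n ≤ p + 1 + n by omega))
    intro k _ hk
    rw [Finset.mem_range] at hk
    rw [qser_coeff, mul_zero]
    rw [Finset.card_erase_of_mem (Finset.mem_univ _), Finset.card_univ, Fintype.card_fin]
    have := l.2
    omega
  rw [h2, ← h1]

/-- Jacobi–Trudi matrix. -/
noncomputable def jtMat (f : ℕ → ℕ) : Matrix (Fin n) (Fin n) (MvPolynomial (Fin n) ℤ) :=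
  fun i j => hhom n ((f i : ℤ) + ((j : ℕ) : ℤ) - (i : ℕ))

/-- Alternant matrix. -/
noncomputable def altMat (f : ℕ → ℕ) : Matrix (Fin n) (Fin n) (MvPolynomial (Fin n) ℤ) :=
  fun i l => (MvPolynomial.X l) ^ (f i + (n - 1 - i))

/-- The auxiliary matrix of elementary polynomials. -/
noncomputable def auxMat : Matrix (Fin n) (Fin n) (MvPolynomial (Fin n) ℤ) :=
  fun j l => PowerSeries.coeff (n - 1 - j) (qser n (Finset.univ.erase l))

lemma jtMat_mul (f : ℕ → ℕ) : jtMat n f * auxMat n = altMat n f := by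
  ext1 i l
  rw [Matrix.mul_apply]
  unfold jtMat auxMat altMat
  rw [pow_eq_sum, ← Finset.sum_range_reflect, Finset.sum_range]
  refine Finset.sum_congr rfl fun j _ => ?_
  have := i.2
  have := j.2
  congr 2
  omega

lemma hhom_zero : hhom n 0 = 1 := by
  rw [hhom, if_pos le_rfl]
  simp [hser]

lemma det_jtMat_zero : (jtMat n 0).det = 1 := by
  rw [Matrix.det_of_isUpperTriangular]
  · apply Finset.prod_eq_one
    intro i _
    simp [jtMat, hhom_zero]
  · intro i j hij
    have : (j : ℕ) < i := hij
    rw [jtMat, hhom, if_neg]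
    simp
    omega

lemma det_altMat (f : ℕ → ℕ) : (altMat n f).det = (jtMat n f).det * (altMat n 0).det := by
  rw [← jtMat_mul, ← jtMat_mul, Matrix.det_mul, Matrix.det_mul, det_jtMat_zero, one_mul]

end Orthonormality

end Partition'

namespace Partition'

section Orthonormality2

variable (n : ℕ)

lemma numMat_neg_left (a b : Fin n → ℤ) (h : ¬ ∀ i, 0 ≤ a i) : numMat n a b = 0 := by
  unfold numMat
  apply Finset.sum_eq_zero
  intro M _
  rw [if_neg]
  rintro ⟨h1, _⟩
  exact h fun i => by rw [← h1 i]; positivity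

lemma coeff_prod_hhom (α : Fin n →₀ ℕ) (b : Fin n → ℤ) (hb : ∑ j, b j = n) :
    MvPolynomial.coeff α (∏ j, hhom n (b j)) = numMat n (fun i => (α i : ℤ)) b := by
  by_cases hpos : ∀ j, 0 ≤ b j
  · have h1 : ∀ j, hhom n (b j) = ∑ l ∈ Finset.finsuppAntidiag (Finset.univ : Finset (Fin n)) (b j).toNat,
        MvPolynomial.monomial l (1 : ℤ) := fun j => by
      rw [hhom, if_pos (hpos j), hser_coeff]
    simp_rw [h1]
    rw [Finset.prod_univ_sum, MvPolynomial.coeff_sum]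
    simp_rw [← MvPolynomial.monomial_sum_one, MvPolynomial.coeff_monomial]
    unfold numMat
    rw [Finset.sum_boole, Finset.sum_boole]
    congr 1
    symm
    apply Finset.card_bij (fun M _ => fun j => Finsupp.equivFunOnFinite.symm fun i => M (i, j))
    · intro M hM
      rw [Finset.mem_filter] at hM ⊢
      obtain ⟨_, h2, h3⟩ := hM
      constructor
      · rw [Fintype.mem_piFinset]
        intro j
        rw [Finset.mem_finsuppAntidiag]
        refine ⟨?_, Finset.subset_univ _⟩
        have := h3 j
        simp only [Finsupp.equivFunOnFinite_symm_apply_apply]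
        omega
      · ext i
        rw [Finsupp.finsetSum_apply]
        have := h2 i
        dsimp only at this
        simp only [Finsupp.equivFunOnFinite_symm_apply_apply]
        omega
    · intro M _ M' _ h
      ext ⟨i, j⟩
      exact DFunLike.congr_fun (congrFun h j) i
    · intro L hL
      rw [Finset.mem_filter, Fintype.mem_piFinset] at hL
      obtain ⟨h2, h3⟩ := hL
      have h4 : ∀ j, (∑ i, L j i : ℕ) = (b j).toNat := fun j =>
        (Finset.mem_finsuppAntidiag.mp (h2 j)).1
      refine ⟨fun x => L x.2 x.1, ?_, ?_⟩
      · rw [Finset.mem_filter, Finset.mem_piAntidiag]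
        refine ⟨⟨?_, fun _ _ => Finset.mem_univ _⟩, ?_, ?_⟩
        · rw [Fintype.sum_prod_type_right]
          simp only [h4]
          zify
          rw [← hb]
          refine Finset.sum_congr rfl fun j _ => ?_
          simp [hpos j]
        · intro i
          dsimp only
          rw [← h3, Finsupp.finsetSum_apply]
        · intro j
          have := h4 j
          have := hpos j
          dsimp only
          omega
      · ext j i
        rfl
  · push Not at hpos
    obtain ⟨j, hj⟩ := hpos
    rw [Finset.prod_eq_zero (Finset.mem_univ j) (by rw [hhom, if_neg (by omega)])]
    unfold numMat
    rw [Finset.sum_eq_zero]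
    · simp
    intro M _
    rw [if_neg]
    rintro ⟨_, h2⟩
    have := h2 j
    have : (0 : ℤ) ≤ ((∑ i, M (i, j) : ℕ) : ℤ) := by positivity
    omega

lemma sum_shift (l : Partition') (hl : size l = n) (τ : Equiv.Perm (Fin n)) :
    ∑ i : Fin n, ((l.1 i : ℤ) + ((τ i : ℕ) : ℤ) - ((i : ℕ) : ℤ)) = n := by
  rw [Finset.sum_sub_distrib, Finset.sum_add_distrib,
    Equiv.sum_comp τ (fun i : Fin n => ((i : ℕ) : ℤ)), add_sub_cancel_right]
  rw [← Finset.sum_range (fun i => (l.1 i : ℤ))]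
  have := sum_range_eq_size l
  rw [hl] at this
  exact_mod_cast this

lemma coeff_det_jt (l : Partition') (hl : size l = n) (α : Fin n →₀ ℕ) :
    MvPolynomial.coeff α (jtMat n l.1).det = ∑ τ : Equiv.Perm (Fin n), (Equiv.Perm.sign τ : ℤ) *
      numMat n (fun i => (α i : ℤ)) (fun i => (l.1 i : ℤ) + ((τ i : ℕ) : ℤ) - (i : ℤ)) := by
  rw [← Matrix.det_transpose, Matrix.det_apply', MvPolynomial.coeff_sum]
  refine Finset.sum_congr rfl fun τ _ => ?_
  have h : (((Equiv.Perm.sign τ : ℤ) : MvPolynomial (Fin n) ℤ)) =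
    MvPolynomial.C (Equiv.Perm.sign τ : ℤ) := by simp
  rw [h, MvPolynomial.coeff_C_mul, ← coeff_prod_hhom n _ _ (sum_shift n l hl τ)]
  rfl

lemma det_alt_eq (f : ℕ → ℕ) : (altMat n f).det = ∑ σ : Equiv.Perm (Fin n),
    MvPolynomial.monomial (Finsupp.equivFunOnFinite.symm
      fun i : Fin n => f (σ i) + (n - 1 - (σ i : ℕ))) (Equiv.Perm.sign σ : ℤ) := by
  rw [Matrix.det_apply']
  refine Finset.sum_congr rfl fun σ _ => ?_
  rw [MvPolynomial.monomial_eq]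
  simp [Finsupp.prod_fintype, altMat]

/-- The exponent `λ + δ`. -/
noncomputable def shiftExp (f : ℕ → ℕ) : Fin n →₀ ℕ :=
  Finsupp.equivFunOnFinite.symm fun i : Fin n => f i + (n - 1 - (i : ℕ))

lemma perm_strictMono_eq_one (σ : Equiv.Perm (Fin n)) (h : StrictMono σ) : σ = 1 := by
  have := Subsingleton.elim (StrictMono.orderIsoOfSurjective σ h σ.surjective) (OrderIso.refl _)
  ext1 i
  exact DFunLike.congr_fun this i

lemma coeff_alt (l m : Partition') (hl : size l = n) (hm : size m = n) :
    MvPolynomial.coeff (shiftExp n l.1) (altMat n m.1).det = if l = m then 1 else 0 := by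
  rw [det_alt_eq, MvPolynomial.coeff_sum]
  simp_rw [MvPolynomial.coeff_monomial]
  split_ifs with h
  · subst h
    rw [Finset.sum_eq_single 1]
    · simp [shiftExp]
    · intro σ _ hσ
      rw [if_neg]
      intro h
      apply hσ
      apply perm_strictMono_eq_one
      intro i j hij
      by_contra hc
      have h1 := DFunLike.congr_fun h i
      have h2 := DFunLike.congr_fun h j
      simp only [shiftExp, Finsupp.equivFunOnFinite_symm_apply_apply] at h1 h2
      have h3 : (σ j : ℕ) ≤ σ i := by simpa using hc
      have h4 := l.2 h3
      have h5 : (i : ℕ) < j := hij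
      have h6 := l.2 h5.le
      have := (σ i).2
      have := (σ j).2
      have := j.2
      omega
    · simp
  · apply Finset.sum_eq_zero
    intro σ _
    rw [if_neg]
    intro h0
    apply h
    have : σ = 1 := by
      apply perm_strictMono_eq_one
      intro i j hij
      by_contra hc
      have h1 := DFunLike.congr_fun h0 i
      have h2 := DFunLike.congr_fun h0 j
      simp only [shiftExp, Finsupp.equivFunOnFinite_symm_apply_apply] at h1 h2
      have h3 : (σ j : ℕ) ≤ σ i := by simpa using hc
      have h4 := m.2 h3
      have h5 : (i : ℕ) < j := hij
      have h6 := l.2 h5.le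
      have := (σ i).2
      have := (σ j).2
      have := j.2
      omega
    subst this
    apply Subtype.ext
    ext i
    by_cases hi : i < n
    · have h1 := DFunLike.congr_fun h0 ⟨i, hi⟩
      simp only [shiftExp, Finsupp.equivFunOnFinite_symm_apply_apply, Equiv.Perm.one_apply] at h1
      omega
    · exact (eq_zero_of_size_le l i (by omega)).trans (eq_zero_of_size_le m i (by omega)).symm

lemma coeff_alt_mul (f : ℕ → ℕ) (s : MvPolynomial (Fin n) ℤ) :
    MvPolynomial.coeff (shiftExp n f) ((altMat n 0).det * s) =
    ∑ σ : Equiv.Perm (Fin n), (Equiv.Perm.sign σ : ℤ) *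
      (if ∀ i : Fin n, 0 ≤ (f i : ℤ) + ((σ i : ℕ) : ℤ) - ((i : ℕ) : ℤ) then
        MvPolynomial.coeff (Finsupp.equivFunOnFinite.symm
          fun i : Fin n => ((f i : ℤ) + ((σ i : ℕ) : ℤ) - ((i : ℕ) : ℤ)).toNat) s else 0) := by
  rw [det_alt_eq, Finset.sum_mul, MvPolynomial.coeff_sum]
  refine Finset.sum_congr rfl fun σ _ => ?_
  rw [MvPolynomial.coeff_monomial_mul']
  have h1 : (Finsupp.equivFunOnFinite.symm
      fun i : Fin n => (0 : ℕ → ℕ) (σ i) + (n - 1 - (σ i : ℕ))) ≤ shiftExp n f ↔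
      ∀ i : Fin n, 0 ≤ (f i : ℤ) + ((σ i : ℕ) : ℤ) - ((i : ℕ) : ℤ) := by
    rw [Finsupp.le_def]
    apply forall_congr'
    intro i
    have := i.2
    have := (σ i).2
    simp only [shiftExp, Finsupp.equivFunOnFinite_symm_apply_apply, Pi.zero_apply]
    omega
  split_ifs with h2 h3 h3
  · congr 2
    ext i
    have := i.2
    have := (σ i).2
    simp only [shiftExp, Finsupp.coe_tsub, Pi.sub_apply, Finsupp.equivFunOnFinite_symm_apply_apply, Pi.zero_apply]
    omega
  · exact absurd (h1.mp h2) h3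
  · exact absurd (h1.mpr h3) h2
  · simp

/-- Orthonormality of the characters given by the Jacobi–Trudi formula. -/
lemma irrChar_orth (l m : Partition') (hl : size l = n) (hm : size m = n) :
    ∑ g, irrChar n l g * irrChar n m g = if l = m then (Nat.factorial n : ℤ) else 0 := by
  have h1 := coeff_alt n l m hl hm
  rw [det_altMat, mul_comm, coeff_alt_mul] at h1
  have h2 : ∑ g, irrChar n l g * irrChar n m g = Nat.factorial n * ∑ σ : Equiv.Perm (Fin n),
      (Equiv.Perm.sign σ : ℤ) * ∑ τ : Equiv.Perm (Fin n), (Equiv.Perm.sign τ : ℤ) *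
      numMat n (fun i => (l.1 i : ℤ) + ((σ i : ℕ) : ℤ) - (i : ℤ))
        (fun i => (m.1 i : ℤ) + ((τ i : ℕ) : ℤ) - (i : ℤ)) := by
    unfold irrChar
    simp_rw [Finset.sum_mul_sum]
    rw [Finset.sum_comm, Finset.mul_sum]
    refine Finset.sum_congr rfl fun σ _ => ?_
    rw [Finset.sum_comm, Finset.mul_sum, Finset.mul_sum]
    refine Finset.sum_congr rfl fun τ _ => ?_
    rw [mul_left_comm, mul_left_comm (Nat.factorial n : ℤ), ← sum_youngCount_mul, Finset.mul_sum,
      Finset.mul_sum]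
    refine Finset.sum_congr rfl fun g _ => ?_
    ring
  rw [h2]
  have h3 : (if l = m then (Nat.factorial n : ℤ) else 0) = Nat.factorial n * (if l = m then 1 else 0) := by
    split_ifs <;> simp
  rw [h3, ← h1]
  congr 1
  refine Finset.sum_congr rfl fun σ _ => ?_
  congr 1
  split_ifs with h4
  · rw [coeff_det_jt n m hm]
    refine Finset.sum_congr rfl fun τ _ => ?_
    congr 2
    ext i
    have := h4 i
    simp only [Finsupp.equivFunOnFinite_symm_apply_apply]
    omega
  · apply Finset.sum_eq_zero
    intro τ _
    rw [numMat_neg_left _ _ _ h4, mul_zero]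

end Orthonormality2

end Partition'

namespace Partition'

section GroupAlgebra

set_option linter.unusedSectionVars false

/-- The complex group algebra. -/
abbrev GA (G : Type) := MonoidAlgebra ℂ G

variable {G : Type} [Group G] [Fintype G]

/-- Group elements inside the group algebra. -/
noncomputable abbrev gof (g : G) : GA G := MonoidAlgebra.single g 1

lemma gof_mul (g h : G) : gof (g * h) = gof g * gof h := by
  simp [gof, MonoidAlgebra.single_mul_single]

lemma gof_one : gof (1 : G) = 1 := rfl

lemma ga_eq_sum (u : GA G) : u = ∑ g, u.coeff g • gof g := by
  ext x
  simp [MonoidAlgebra.coeff_sum, Finsupp.single_apply]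

lemma coeff_sum_gof (f : G → ℂ) (x : G) : (∑ g, f g • gof g : GA G).coeff x = f x := by
  simp [MonoidAlgebra.coeff_sum, Finsupp.single_apply]

lemma ga_coeff_mul (u w : GA G) (x : G) : (u * w).coeff x = ∑ a, u.coeff a * w.coeff (a⁻¹ * x) := by
  rw [MonoidAlgebra.coeff_mul_apply_left, Finsupp.sum_fintype]
  intro i
  simp

/-- Class sum of an element. -/
noncomputable def zz (u : GA G) (y : G) : ℂ := ∑ x : G, u.coeff (x * y * x⁻¹)

/-- The trace of `y ↦ u y w`. -/
noncomputable def tt (u w : GA G) : ℂ := ∑ y, zz u y * w.coeff y⁻¹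

/-- The map `y ↦ u y w`. -/
noncomputable def sandwich (u w : GA G) : GA G →ₗ[ℂ] GA G :=
  LinearMap.mulLeft ℂ u ∘ₗ LinearMap.mulRight ℂ w

lemma sandwich_apply (u w y : GA G) : sandwich u w y = u * y * w := by
  simp [sandwich, mul_assoc]

instance : Module.Finite ℂ (GA G) := Module.Finite.of_basis (MonoidAlgebra.basis G ℂ)

lemma trace_sandwich (u w : GA G) : LinearMap.trace ℂ (GA G) (sandwich u w) = tt u w := by
  rw [LinearMap.trace_eq_matrix_trace ℂ (MonoidAlgebra.basis G ℂ), Matrix.trace]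
  have h : ∀ x : G, (LinearMap.toMatrix (MonoidAlgebra.basis G ℂ) (MonoidAlgebra.basis G ℂ)
      (sandwich u w)).diag x = ∑ a, u.coeff a * w.coeff (x⁻¹ * a⁻¹ * x) := by
    intro x
    rw [Matrix.diag_apply, LinearMap.toMatrix_apply, sandwich_apply]
    have : (MonoidAlgebra.basis G ℂ) x = gof x := by simp
    rw [this]
    have h2 : ∀ v : GA G, (MonoidAlgebra.basis G ℂ).repr v x = v.coeff x := fun v => rfl
    rw [h2, mul_assoc, ga_coeff_mul]
    refine Finset.sum_congr rfl fun a _ => ?_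
    rw [MonoidAlgebra.coeff_single_mul_apply, one_mul, mul_assoc]
  simp_rw [h, tt, zz, Finset.sum_mul]
  conv_rhs => rw [Finset.sum_comm]
  refine Finset.sum_congr rfl fun x _ => ?_
  rw [← (MulAut.conj x).toEquiv.sum_comp]
  refine Finset.sum_congr rfl fun y _ => ?_
  simp [mul_assoc]

lemma zz_conj (u : GA G) (x y : G) : zz u (x * y * x⁻¹) = zz u y := by
  unfold zz
  rw [← Equiv.sum_comp (Equiv.mulRight x⁻¹)]
  refine Finset.sum_congr rfl fun z _ => ?_
  simp [mul_assoc]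

lemma zz_smul (r : ℂ) (u : GA G) (y : G) : zz (r • u) y = r * zz u y := by
  simp [zz, Finset.mul_sum]

/-- Averaging a class function against an element. -/
lemma sum_class_mul {H : Type} [Group H] [Fintype H] (φ : H → ℂ) (hφ : ∀ x y, φ (x * y * x⁻¹) = φ y)
    (f : GA H) :
    (Fintype.card H : ℂ) * ∑ h, φ h * f.coeff h⁻¹ = ∑ h, φ h * zz f h⁻¹ := by
  unfold zz
  simp_rw [Finset.mul_sum]
  rw [← Finset.mul_sum, Finset.sum_comm (f := fun h x => _ * _)]
  have : ∀ x : H, ∑ h, φ h * f.coeff (x * h⁻¹ * x⁻¹) = ∑ h, φ h * f.coeff h⁻¹ := by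
    intro x
    rw [← (MulAut.conj x).toEquiv.sum_comp (fun h => φ h * f.coeff h⁻¹)]
    refine Finset.sum_congr rfl fun y _ => ?_
    simp [mul_assoc]
    left
    rw [← mul_assoc, hφ]
  simp_rw [this]
  simp

lemma tt_conj (u w : GA G) (p : G) : tt u (gof p * w * gof p⁻¹) = tt u w := by
  unfold tt
  rw [← (MulAut.conj p).toEquiv.sum_comp]
  refine Finset.sum_congr rfl fun y _ => ?_
  have h : (MulAut.conj p).toEquiv y = p * y * p⁻¹ := rfl
  rw [h, zz_conj]
  congr 1
  rw [MonoidAlgebra.coeff_mul_single_apply, MonoidAlgebra.coeff_single_mul_apply]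
  simp [mul_assoc]

lemma tt_sum {ι : Type} (s : Finset ι) (u : GA G) (w : ι → GA G) :
    tt u (∑ i ∈ s, w i) = ∑ i ∈ s, tt u (w i) := by
  unfold tt
  simp_rw [MonoidAlgebra.coeff_sum, Finsupp.finsetSum_apply, Finset.mul_sum]
  exact Finset.sum_comm

/-- If `u y w` is always a multiple of `c`, the trace is read off. -/
lemma tt_of_rank_one (u w c : GA G) (hc : c ≠ 0) (h : ∀ g : G, ∃ r : ℂ, u * gof g * w = r • c) (r : ℂ)
    (hr : u * c * w = r • c) : tt u w = r := by
  choose φ hφ using h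
  have h1 : sandwich u w = LinearMap.smulRight ((MonoidAlgebra.basis G ℂ).constr ℂ φ) c := by
    apply (MonoidAlgebra.basis G ℂ).ext
    intro g
    rw [sandwich_apply, LinearMap.smulRight_apply, Module.Basis.constr_basis]
    have : (MonoidAlgebra.basis G ℂ) g = gof g := by simp
    rw [this, hφ]
  rw [← trace_sandwich, h1, LinearMap.trace_smulRight]
  have h2 := sandwich_apply u w c
  rw [h1, LinearMap.smulRight_apply, hr] at h2
  exact smul_left_injective ℂ hc h2

lemma tt_one_left (w : GA G) : tt 1 w = Fintype.card G * w.coeff 1 := by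
  unfold tt zz
  have : ∀ x y : G, (1 : GA G).coeff (x * y * x⁻¹) = if y = 1 then 1 else 0 := by
    intro x y
    rw [MonoidAlgebra.one_def, MonoidAlgebra.coeff_single, Finsupp.single_apply]
    have h : 1 = x * y * x⁻¹ ↔ y = 1 := by
      rw [eq_comm, mul_inv_eq_one]; simp
    simp only [h]
  simp_rw [this]
  simp

/-- If `c * c = κ c` and `c` has nonzero trace, then `κ ≠ 0`. -/
lemma ne_zero_of_sq (c : GA G) (κ : ℂ) (h : c * c = κ • c) (h1 : c.coeff 1 ≠ 0) : κ ≠ 0 := by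
  rintro rfl
  have hn : IsNilpotent (sandwich 1 c) := by
    refine ⟨2, ?_⟩
    ext1 y
    rw [pow_two]
    apply LinearMap.ext
    intro z
    simp only [LinearMap.comp_apply, Module.End.mul_apply, sandwich_apply, one_mul, mul_assoc, h]
    simp
  have h2 := LinearMap.isNilpotent_trace_of_isNilpotent hn
  rw [trace_sandwich, tt_one_left, isNilpotent_iff_eq_zero] at h2
  rcases mul_eq_zero.mp h2 with h3 | h3
  · simp at h3
  · exact h1 h3

/-- The image of an idempotent sandwich. -/
lemma tt_eq_finrank (e f : GA G) (he : e * e = e) (hf : f * f = f) :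
    tt e f = Module.finrank ℂ (LinearMap.range (sandwich e f)) := by
  rw [← trace_sandwich]
  apply LinearMap.IsProj.trace
  constructor
  · intro x
    exact ⟨x, rfl⟩
  · rintro _ ⟨x, rfl⟩
    simp only [sandwich_apply, mul_assoc, hf]
    rw [← mul_assoc, he]

end GroupAlgebra

end Partition'

namespace Partition'

section Young

set_option linter.unusedSectionVars false

variable {n : ℕ} {J K : Type}

/-- Sum over the stabilizer of a labelling. -/
noncomputable def stabSum (f : Fin n → J) : GA (Equiv.Perm (Fin n)) :=
  ∑ σ ∈ Finset.univ.filter (fun σ : Equiv.Perm (Fin n) => ∀ t, f (σ t) = f t), gof σ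

/-- Signed sum over the stabilizer of a labelling. -/
noncomputable def sgnSum (f : Fin n → J) : GA (Equiv.Perm (Fin n)) :=
  ∑ σ ∈ Finset.univ.filter (fun σ : Equiv.Perm (Fin n) => ∀ t, f (σ t) = f t),
    ((Equiv.Perm.sign σ : ℤ) : ℂ) • gof σ

lemma stabSum_coeff (f : Fin n → J) (x : Equiv.Perm (Fin n)) :
    (stabSum f).coeff x = if ∀ t, f (x t) = f t then 1 else 0 := by
  rw [stabSum, MonoidAlgebra.coeff_sum, Finsupp.finsetSum_apply, Finset.sum_filter]
  rw [Finset.sum_eq_single x]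
  · simp
  · intro y _ hy
    simp [Finsupp.single_apply, hy]
  · simp

lemma sgnSum_coeff (f : Fin n → J) (x : Equiv.Perm (Fin n)) :
    (sgnSum f).coeff x = if ∀ t, f (x t) = f t then ((Equiv.Perm.sign x : ℤ) : ℂ) else 0 := by
  rw [sgnSum, MonoidAlgebra.coeff_sum, Finsupp.finsetSum_apply, Finset.sum_filter]
  rw [Finset.sum_eq_single x]
  · simp
  · intro y _ hy
    simp [Finsupp.single_apply, hy]
  · simp

lemma stab_mul_iff (f : Fin n → J) (p x : Equiv.Perm (Fin n)) (hp : ∀ t, f (p t) = f t) :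
    (∀ t, f ((p * x) t) = f t) ↔ ∀ t, f (x t) = f t := by
  simp [Equiv.Perm.mul_apply, hp]

lemma stab_inv (f : Fin n → J) (p : Equiv.Perm (Fin n)) (hp : ∀ t, f (p t) = f t) :
    ∀ t, f (p⁻¹ t) = f t := fun t => by
  have := hp (p⁻¹ t)
  simpa using this.symm

lemma stab_mul_iff' (f : Fin n → J) (p x : Equiv.Perm (Fin n)) (hp : ∀ t, f (p t) = f t) :
    (∀ t, f ((x * p) t) = f t) ↔ ∀ t, f (x t) = f t := by
  constructor
  · intro h t
    have := h (p⁻¹ t)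
    rw [← stab_inv f p hp t, ← this]
    simp
  · intro h t
    rw [Equiv.Perm.mul_apply, h, hp]

lemma gof_mul_stabSum (f : Fin n → J) (p : Equiv.Perm (Fin n)) (hp : ∀ t, f (p t) = f t) :
    gof p * stabSum f = stabSum f := by
  ext x
  rw [MonoidAlgebra.coeff_single_mul_apply, one_mul, stabSum_coeff, stabSum_coeff]
  exact if_congr (stab_mul_iff f _ _ (stab_inv f p hp)) rfl rfl

lemma stabSum_mul_gof (f : Fin n → J) (p : Equiv.Perm (Fin n)) (hp : ∀ t, f (p t) = f t) :
    stabSum f * gof p = stabSum f := by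
  ext x
  rw [MonoidAlgebra.coeff_mul_single_apply, mul_one, stabSum_coeff, stabSum_coeff]
  exact if_congr (stab_mul_iff' f _ _ (stab_inv f p hp)) rfl rfl

lemma sgnSum_mul_gof (f : Fin n → J) (p : Equiv.Perm (Fin n)) (hp : ∀ t, f (p t) = f t) :
    sgnSum f * gof p = ((Equiv.Perm.sign p : ℤ) : ℂ) • sgnSum f := by
  ext x
  rw [MonoidAlgebra.coeff_mul_single_apply, mul_one, MonoidAlgebra.coeff_smul_apply, sgnSum_coeff,
    sgnSum_coeff, smul_eq_mul, mul_ite, mul_zero]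
  refine if_congr (stab_mul_iff' f _ _ (stab_inv f p hp)) ?_ rfl
  rw [Equiv.Perm.sign_mul, Equiv.Perm.sign_inv]
  push_cast
  ring

lemma gof_mul_stabSum' (f : Fin n → J) (x : Equiv.Perm (Fin n)) :
    gof x * stabSum f = stabSum (fun t => f (x⁻¹ t)) * gof x := by
  ext y
  rw [MonoidAlgebra.coeff_single_mul_apply, one_mul, MonoidAlgebra.coeff_mul_single_apply, mul_one,
    stabSum_coeff, stabSum_coeff]
  refine if_congr ?_ rfl rfl
  constructor
  · intro h t
    have := h (x⁻¹ t)
    simpa [Equiv.Perm.mul_apply] using this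
  · intro h t
    have := h (x t)
    simpa [Equiv.Perm.mul_apply] using this

lemma sgnSum_mul_stabSum_eq_zero (h : Fin n → K) (f : Fin n → J) (s t : Fin n) (hst : s ≠ t)
    (h1 : h s = h t) (h2 : f s = f t) : sgnSum h * stabSum f = 0 := by
  have e1 : ∀ {L : Type} (g : Fin n → L), g s = g t → ∀ r, g (Equiv.swap s t r) = g r := by
    intro L g hg r
    by_cases hs : r = s
    · subst hs; simp [hg]
    by_cases ht : r = t
    · subst ht; simp [hg]
    rw [Equiv.swap_apply_of_ne_of_ne hs ht]
  have h3 := sgnSum_mul_gof h _ (e1 h h1)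
  have h4 := gof_mul_stabSum f _ (e1 f h2)
  have h5 : sgnSum h * stabSum f = - (sgnSum h * stabSum f) := by
    conv_lhs => rw [← h4, ← mul_assoc, h3, Equiv.Perm.sign_swap hst]
    simp
  have h6 : (2 : ℂ) • (sgnSum h * stabSum f) = 0 := by
    rw [two_smul]
    nth_rewrite 1 [h5]
    exact neg_add_cancel _
  exact (smul_eq_zero.mp h6).resolve_left two_ne_zero

variable (l : Partition') (n)

/-- Row labelling. -/
noncomputable def rowL (t : Fin n) : ℕ := rowOf l t

/-- Column labelling. -/
noncomputable def colL (t : Fin n) : ℕ := colOf l t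

/-- The Young symmetrizer in the group algebra. -/
noncomputable def yc : GA (Equiv.Perm (Fin n)) := sgnSum (colL n l) * stabSum (rowL n l)

/-- The normalization constant. -/
noncomputable def ykap : ℂ := (yc n l * yc n l).coeff 1


lemma yb_stab (hn : size l = n) (f : Fin n → ℕ) : (sgnSum (colL n l) * stabSum f = 0) ∨
    (∑ t, rowL n l t ≤ ∑ t, f t ∧ (∑ t, rowL n l t = ∑ t, f t →
      ∃ q : Equiv.Perm (Fin n), (∀ t, colL n l (q t) = colL n l t) ∧ ∀ t, f (q t) = rowL n l t)) := by
  by_cases h : ∀ s t : Fin n, colL n l s = colL n l t → f s = f t → s = t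
  · right
    exact col_inj_filling l n hn f h
  · left
    push Not at h
    obtain ⟨s, t, h1, h2, h3⟩ := h
    exact sgnSum_mul_stabSum_eq_zero _ _ s t h3 h1 h2

lemma vn_gof (hn : size l = n) (x : Equiv.Perm (Fin n)) :
    ∃ r : ℂ, sgnSum (colL n l) * gof x * stabSum (rowL n l) = r • yc n l := by
  rw [mul_assoc, gof_mul_stabSum', ← mul_assoc]
  rcases yb_stab n l hn (fun t => rowL n l (x⁻¹ t)) with h | ⟨_, h⟩
  · exact ⟨0, by rw [h]; simp⟩
  · obtain ⟨q, hq1, hq2⟩ := h (Equiv.sum_comp x⁻¹ (rowL n l)).symm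
    refine ⟨((Equiv.Perm.sign q : ℤ) : ℂ), ?_⟩
    have e : (fun t => rowL n l (x⁻¹ t)) = fun t => rowL n l (q⁻¹ t) := by
      funext t
      have := hq2 (q⁻¹ t)
      simpa using this
    have hp : ∀ t, rowL n l ((q⁻¹ * x) t) = rowL n l t := by
      intro t
      have := congrFun e (x t)
      simpa using this.symm
    have e2 : x = q * (q⁻¹ * x) := by simp
    calc sgnSum (colL n l) * stabSum (fun t => rowL n l (x⁻¹ t)) * gof x
        = sgnSum (colL n l) * (stabSum (fun t => rowL n l (q⁻¹ t)) * gof q) * gof (q⁻¹ * x) := by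
          conv_lhs => rw [e, e2, gof_mul]
          simp only [mul_assoc]
      _ = _ := by
          rw [← gof_mul_stabSum', ← mul_assoc, sgnSum_mul_gof _ q hq1, mul_assoc, stabSum_mul_gof _ _ hp,
            yc, smul_mul_assoc]

lemma vn (hn : size l = n) (u : GA (Equiv.Perm (Fin n))) :
    ∃ r : ℂ, sgnSum (colL n l) * u * stabSum (rowL n l) = r • yc n l := by
  choose φ hφ using vn_gof n l hn
  refine ⟨∑ g, u.coeff g * φ g, ?_⟩
  conv_lhs => rw [ga_eq_sum u]
  rw [Finset.mul_sum, Finset.sum_mul, Finset.sum_smul]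
  refine Finset.sum_congr rfl fun g _ => ?_
  rw [mul_smul_comm, smul_mul_assoc, hφ, smul_smul]

lemma vn_zero (hn : size l = n) (f : Fin n → ℕ) (hf : ∑ t, f t < ∑ t, rowL n l t) (x : Equiv.Perm (Fin n)) :
    sgnSum (colL n l) * gof x * stabSum f = 0 := by
  rw [mul_assoc, gof_mul_stabSum', ← mul_assoc]
  rcases yb_stab n l hn (fun t => f (x⁻¹ t)) with h | ⟨h, _⟩
  · rw [h, zero_mul]
  · rw [Equiv.sum_comp x⁻¹ f] at h
    omega

lemma yc_coeff_one (hn : size l = n) : (yc n l).coeff 1 = 1 := by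
  rw [yc, ga_coeff_mul, Finset.sum_eq_single 1]
  · simp [stabSum_coeff, sgnSum_coeff]
  · intro x _ hx
    rw [sgnSum_coeff, stabSum_coeff]
    by_cases h1 : ∀ t, colL n l (x t) = colL n l t
    · by_cases h2 : ∀ t, rowL n l ((x⁻¹ * 1) t) = rowL n l t
      · exfalso
        apply hx
        ext t
        rw [mul_one] at h2
        have h3 := stab_inv _ _ h2
        rw [inv_inv] at h3
        exact box_inj l _ _ (by have := (x t).2; omega) (by have := t.2; rw [Equiv.Perm.one_apply]; omega) (h3 t) (h1 t)
      · rw [if_neg h2, mul_zero]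
    · rw [if_neg h1, zero_mul]
  · simp

lemma yc_ne_zero (hn : size l = n) : yc n l ≠ 0 := by
  intro h
  have := yc_coeff_one n l hn
  rw [h] at this
  simp at this

lemma yc_sandwich (hn : size l = n) (u : GA (Equiv.Perm (Fin n))) : ∃ r : ℂ, yc n l * u * yc n l = r • yc n l := by
  obtain ⟨r, hr⟩ := vn n l hn (stabSum (rowL n l) * u * sgnSum (colL n l))
  refine ⟨r, ?_⟩
  rw [← hr]
  simp only [yc, mul_assoc]

lemma yc_sq (hn : size l = n) : yc n l * yc n l = ykap n l • yc n l := by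
  obtain ⟨r, hr⟩ := yc_sandwich n l hn 1
  rw [mul_one] at hr
  have : ykap n l = r := by
    rw [ykap, hr, MonoidAlgebra.coeff_smul_apply, yc_coeff_one n l hn, smul_eq_mul, mul_one]
  rw [this, hr]

lemma ykap_ne_zero (hn : size l = n) : ykap n l ≠ 0 :=
  ne_zero_of_sq _ _ (yc_sq n l hn) (by rw [yc_coeff_one n l hn]; exact one_ne_zero)

lemma tt_yc_yc (hn : size l = n) : tt (yc n l) (yc n l) = ykap n l * ykap n l := by
  apply tt_of_rank_one _ _ (yc n l) (yc_ne_zero n l hn) (fun g => yc_sandwich n l hn (gof g))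
  rw [yc_sq n l hn, smul_mul_assoc, yc_sq n l hn, smul_smul]

/-- Order of the stabilizer. -/
noncomputable def stabCard {J : Type} {n : ℕ} (f : Fin n → J) : ℕ :=
  (Finset.univ.filter (fun σ : Equiv.Perm (Fin n) => ∀ t, f (σ t) = f t)).card

lemma stabSum_sq {J : Type} {n : ℕ} (f : Fin n → J) :
    stabSum f * stabSum f = (stabCard f : ℂ) • stabSum f := by
  conv_lhs => arg 1; rw [stabSum]
  rw [Finset.sum_mul, Finset.sum_congr rfl (fun σ hσ => gof_mul_stabSum _ σ (Finset.mem_filter.mp hσ).2)]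
  rw [Finset.sum_const, stabCard, Nat.cast_smul_eq_nsmul]

lemma yc_mul_stab : yc n l * stabSum (rowL n l) = (stabCard (rowL n l) : ℂ) • yc n l := by
  rw [yc, mul_assoc, stabSum_sq, mul_smul_comm]

lemma tt_yc_stab (hn : size l = n) : tt (yc n l) (stabSum (rowL n l)) = ykap n l * stabCard (rowL n l) := by
  apply tt_of_rank_one _ _ (yc n l) (yc_ne_zero n l hn)
  · intro g
    obtain ⟨r, hr⟩ := vn n l hn (stabSum (rowL n l) * gof g)
    refine ⟨r, ?_⟩
    rw [← hr]
    simp only [yc, mul_assoc]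
  · rw [yc_sq n l hn, smul_mul_assoc, yc_mul_stab, smul_smul]

lemma tt_yc_zero (hn : size l = n) (f : Fin n → ℕ) (hf : ∑ t, f t < ∑ t, rowL n l t) : tt (yc n l) (stabSum f) = 0 := by
  apply tt_of_rank_one _ _ (yc n l) (yc_ne_zero n l hn)
  · intro g
    refine ⟨0, ?_⟩
    rw [zero_smul, yc, ga_eq_sum (stabSum (rowL n l)), Finset.mul_sum, Finset.sum_mul, Finset.sum_mul]
    apply Finset.sum_eq_zero
    intro x _
    rw [mul_smul_comm, smul_mul_assoc, smul_mul_assoc, mul_assoc (sgnSum _), ← gof_mul, vn_zero n l hn f hf,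
      smul_zero]
  · rw [zero_smul]
    have : ∀ u, yc n l * u * stabSum f = 0 := by
      intro u
      rw [yc, mul_assoc (sgnSum _), ga_eq_sum (stabSum (rowL n l) * u), Finset.mul_sum, Finset.sum_mul]
      apply Finset.sum_eq_zero
      intro x _
      rw [mul_smul_comm, smul_mul_assoc, vn_zero n l hn f hf, smul_zero]
    exact this _

end Young

end Partition'

namespace Partition'

section Characters

set_option linter.unusedSectionVars false

variable (n : ℕ) (l : Partition')

lemma stabSum_int {J : Type} (f : Fin n → J) (x) :
    (stabSum f).coeff x ∈ (Int.castRingHom ℂ).range := by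
  rw [stabSum_coeff]
  split_ifs
  · exact one_mem _
  · exact zero_mem _

lemma sgnSum_int {J : Type} (f : Fin n → J) (x) :
    (sgnSum f).coeff x ∈ (Int.castRingHom ℂ).range := by
  rw [sgnSum_coeff]
  split_ifs
  · exact ⟨_, rfl⟩
  · exact zero_mem _

lemma mul_int {G : Type} [Group G] [Fintype G] (u w : GA G)
    (hu : ∀ x, u.coeff x ∈ (Int.castRingHom ℂ).range)
    (hw : ∀ x, w.coeff x ∈ (Int.castRingHom ℂ).range) (x : G) :
    (u * w).coeff x ∈ (Int.castRingHom ℂ).range := by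
  rw [ga_coeff_mul]
  exact sum_mem fun a _ => mul_mem (hu _) (hw _)

lemma yc_int (x) : (yc n l).coeff x ∈ (Int.castRingHom ℂ).range :=
  mul_int _ _ (sgnSum_int n _) (stabSum_int n _) x

lemma ykap_int : ykap n l ∈ (Int.castRingHom ℂ).range :=
  mul_int _ _ (yc_int n l) (yc_int n l) _

lemma zz_int (x) : zz (yc n l) x ∈ (Int.castRingHom ℂ).range :=
  sum_mem fun _ _ => yc_int n l _

lemma zz_inv (u : GA (Equiv.Perm (Fin n))) (g : Equiv.Perm (Fin n)) : zz u g⁻¹ = zz u g := by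
  have h : IsConj g g⁻¹ := by
    rw [Equiv.Perm.isConj_iff_cycleType_eq, Equiv.Perm.cycleType_inv]
  obtain ⟨c, hc⟩ := isConj_iff.mp h
  rw [← hc, zz_conj]

lemma sum_val_fib (f : Fin n → Fin n) : ∑ t, (f t : ℕ) = ∑ i : Fin n, (i : ℕ) * fib f i := by
  rw [← Finset.sum_fiberwise Finset.univ f]
  refine Finset.sum_congr rfl fun i _ => ?_
  rw [Finset.sum_congr rfl (g := fun _ => (i : ℕ))]
  · rw [Finset.sum_const, smul_eq_mul, mul_comm, fib]
    congr!
  · intro t ht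
    rw [(Finset.mem_filter.mp ht).2]

/-- Row labelling with values in `Fin n`. -/
noncomputable def rowF (t : Fin n) : Fin n := ⟨rowOf l t, (rowOf_le l t).trans_lt t.2⟩

lemma fib_rowF (hn : size l = n) (i : Fin n) : fib (rowF n l) i = l.1 i := by
  rw [← card_row l n hn i, fib]
  congr 1
  ext t
  simp [rowF, Fin.ext_iff]

lemma sum_rowL (hn : size l = n) : ∑ t, rowL n l t = ∑ i : Fin n, (i : ℕ) * l.1 i := by
  have := sum_val_fib n (rowF n l)
  simp_rw [fib_rowF n l hn] at this
  rw [← this]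
  rfl

lemma sum_zz_young (u : GA (Equiv.Perm (Fin n))) (a : Fin n → ℤ) :
    ∑ g, zz u g * youngCount n a g = ∑ f : Fin n → Fin n,
      if ∀ i, (fib f i : ℤ) = a i then tt u (stabSum (fun t => (f t : ℕ))) else 0 := by
  simp_rw [youngCount_eq]
  push_cast
  simp_rw [Finset.mul_sum]
  rw [Finset.sum_comm]
  refine Finset.sum_congr rfl fun f _ => ?_
  by_cases h : ∀ i, (fib f i : ℤ) = a i
  · rw [if_pos h, tt]
    refine Finset.sum_congr rfl fun g _ => ?_
    rw [stabSum_coeff]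
    congr 1
    have key : ((∀ i, (fib f i : ℤ) = a i) ∧ f ∘ g = f) ↔ ∀ t, (f (g⁻¹ t) : ℕ) = f t := by
      constructor
      · rintro ⟨_, h2⟩ t
        have h3 := congrFun h2 (g⁻¹ t)
        simp only [Function.comp] at h3
        rw [← h3]
        simp
      · intro h2
        refine ⟨h, ?_⟩
        funext t
        have h3 := h2 (g t)
        simp only [Function.comp]
        apply Fin.ext
        rw [← h3]
        simp
    split_ifs with h5 h6 h6
    · rfl
    · exact absurd (key.mp h5) h6
    · exact absurd (key.mpr h6) h5
    · rfl
  · rw [if_neg h]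
    apply Finset.sum_eq_zero
    intro g _
    rw [if_neg (fun h2 => h h2.1), mul_zero]

lemma sum_mul_perm_lt (σ : Equiv.Perm (Fin n)) (hσ : σ ≠ 1) :
    ∑ i : Fin n, ((i : ℕ) : ℤ) * ((σ i : ℕ) : ℤ) < ∑ i : Fin n, ((i : ℕ) : ℤ) * ((i : ℕ) : ℤ) := by
  have h1 : ∑ i : Fin n, ((σ i : ℕ) : ℤ) * ((σ i : ℕ) : ℤ) = ∑ i : Fin n, ((i : ℕ) : ℤ) * ((i : ℕ) : ℤ) :=
    Equiv.sum_comp σ (fun i : Fin n => ((i : ℕ) : ℤ) * ((i : ℕ) : ℤ))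
  have h2 : 0 < ∑ i : Fin n, (((i : ℕ) : ℤ) - ((σ i : ℕ) : ℤ)) ^ 2 := by
    apply Finset.sum_pos'
    · intro i _; positivity
    · by_contra hc
      push Not at hc
      apply hσ
      ext i
      have h3 := hc i (Finset.mem_univ _)
      have h4 : (((i : ℕ) : ℤ) - ((σ i : ℕ) : ℤ)) = 0 := by
        by_contra h5
        have : 0 < (((i : ℕ) : ℤ) - ((σ i : ℕ) : ℤ)) ^ 2 := by positivity
        omega
      rw [Equiv.Perm.one_apply]
      omega
  have h3 : ∑ i : Fin n, (((i : ℕ) : ℤ) - ((σ i : ℕ) : ℤ)) ^ 2 =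
      ∑ i : Fin n, ((i : ℕ) : ℤ) * ((i : ℕ) : ℤ) + ∑ i : Fin n, ((σ i : ℕ) : ℤ) * ((σ i : ℕ) : ℤ)
      - 2 * ∑ i : Fin n, ((i : ℕ) : ℤ) * ((σ i : ℕ) : ℤ) := by
    rw [Finset.mul_sum, ← Finset.sum_add_distrib, ← Finset.sum_sub_distrib]
    refine Finset.sum_congr rfl fun i _ => ?_
    ring
  omega

lemma stabSum_congr {J K : Type} (f : Fin n → J) (g : Fin n → K)
    (h : ∀ s t, f s = f t ↔ g s = g t) : stabSum f = stabSum g := by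
  ext x
  rw [stabSum_coeff, stabSum_coeff]
  exact if_congr (forall_congr' fun t => h _ _) rfl rfl

lemma stabCard_congr {J K : Type} (f : Fin n → J) (g : Fin n → K)
    (h : ∀ s t, f s = f t ↔ g s = g t) : stabCard f = stabCard g := by
  unfold stabCard
  congr 1
  ext x
  simp [h]

lemma stabCard_comp {J : Type} (f : Fin n → J) (p : Equiv.Perm (Fin n)) :
    stabCard (f ∘ p) = stabCard f := by
  unfold stabCard
  apply Finset.card_bij (fun x _ => p * x * p⁻¹)
  · intro x hx
    rw [Finset.mem_filter] at hx ⊢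
    refine ⟨Finset.mem_univ _, fun t => ?_⟩
    have := hx.2 (p⁻¹ t)
    simpa [Equiv.Perm.mul_apply] using this
  · intro x _ y _ h
    simpa using h
  · intro y hy
    rw [Finset.mem_filter] at hy
    refine ⟨p⁻¹ * y * p, ?_, by simp [mul_assoc]⟩
    rw [Finset.mem_filter]
    refine ⟨Finset.mem_univ _, fun t => ?_⟩
    have := hy.2 (p t)
    simpa [Equiv.Perm.mul_apply] using this

lemma tt_yc_same (hn : size l = n) (f : Fin n → Fin n) (hf : ∀ i, fib f i = l.1 i) :
    tt (yc n l) (stabSum (fun t => (f t : ℕ))) = ykap n l * stabCard f := by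
  obtain ⟨p, hp⟩ := exists_perm_of_fib f (rowF n l) (fun i => (hf i).trans (fib_rowF n l hn i).symm)
  have h1 : stabSum (fun t => (f t : ℕ)) = gof p⁻¹ * stabSum (rowL n l) * gof p⁻¹⁻¹ := by
    rw [gof_mul_stabSum', mul_assoc, ← gof_mul, mul_inv_cancel, gof_one, mul_one]
    congr 1
    funext t
    rw [← hp]
    simp [rowL, rowF]
  rw [h1, tt_conj, tt_yc_stab n l hn, ← hp, stabCard_comp]
  rw [stabCard_congr n (rowL n l) (rowF n l)]
  intro s t
  simp [rowF, rowL]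

lemma sum_zz_irr (hn : size l = n) :
    ∑ g, zz (yc n l) g * irrChar n l g = ykap n l * Nat.factorial n := by
  have h1 : ∀ σ : Equiv.Perm (Fin n), ∑ g, zz (yc n l) g *
      youngCount n (fun i => (l.1 i : ℤ) + ((σ i : ℕ) : ℤ) - (i : ℤ)) g =
      if σ = 1 then ykap n l * Nat.factorial n else 0 := by
    intro σ
    rw [sum_zz_young]
    split_ifs with hσ
    · subst hσ
      have h2 := orbit_count (n := n) (fun i : Fin n => l.1 i) (by
        have := sum_range_eq_size l
        rw [hn, Finset.sum_range] at this
        exact this)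
      rw [← h2]
      push_cast
      rw [Finset.mul_sum]
      refine Finset.sum_congr rfl fun f _ => ?_
      by_cases h4 : ∀ i : Fin n, fib f i = l.1 i
      · have h3 : ∀ i : Fin n, (fib f i : ℤ) = (l.1 i : ℤ) + (((id i : Fin n) : ℕ) : ℤ) - (i : ℤ) := by
          intro i
          have := h4 i
          simp only [id]
          omega
        refine (if_pos h3).trans ?_
        rw [if_pos h4, tt_yc_same n l hn f h4]
        congr 2
        unfold stabCard
        congr 1
        ext x
        simp [funext_iff]
      · have h3 : ¬ ∀ i : Fin n, (fib f i : ℤ) = (l.1 i : ℤ) + (((id i : Fin n) : ℕ) : ℤ) - (i : ℤ) := by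
          intro h3
          apply h4
          intro i
          have := h3 i
          simp only [id] at this
          omega
        refine (if_neg h3).trans ?_
        rw [if_neg h4, mul_zero]
    · apply Finset.sum_eq_zero
      intro f _
      split_ifs with h2
      · apply tt_yc_zero n l hn
        rw [sum_rowL n l hn, sum_val_fib]
        zify
        have h3 : ∑ i : Fin n, ((i : ℕ) : ℤ) * (fib f i : ℤ) =
            ∑ i : Fin n, ((i : ℕ) : ℤ) * (l.1 i : ℤ) + ∑ i : Fin n, ((i : ℕ) : ℤ) * ((σ i : ℕ) : ℤ) -
            ∑ i : Fin n, ((i : ℕ) : ℤ) * ((i : ℕ) : ℤ) := by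
          rw [← Finset.sum_add_distrib, ← Finset.sum_sub_distrib]
          refine Finset.sum_congr rfl fun i _ => ?_
          rw [h2 i]
          ring
        have := sum_mul_perm_lt n σ hσ
        omega
      · rfl
  unfold irrChar
  push_cast
  simp_rw [Finset.mul_sum]
  rw [Finset.sum_comm]
  rw [Finset.sum_congr rfl (g := fun σ => ((Equiv.Perm.sign σ : ℤ) : ℂ) *
    (if σ = 1 then ykap n l * Nat.factorial n else 0))]
  · simp
  · intro σ _
    rw [← h1, Finset.mul_sum]
    refine Finset.sum_congr rfl fun g _ => ?_
    ring

/-- The class sum of the Young symmetrizer is a multiple of the irreducible character. -/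
lemma zz_yc (hn : size l = n) (g : Equiv.Perm (Fin n)) :
    zz (yc n l) g = ykap n l * irrChar n l g := by
  have hY : ∀ g, ∃ z : ℤ, zz (yc n l) g - ykap n l * irrChar n l g = z := by
    intro g
    have : zz (yc n l) g - ykap n l * irrChar n l g ∈ (Int.castRingHom ℂ).range :=
      sub_mem (zz_int n l g) (mul_mem (ykap_int n l) ⟨_, rfl⟩)
    obtain ⟨z, hz⟩ := this
    exact ⟨z, hz.symm⟩
  choose Y hY using hY
  have h1 : ∑ g, zz (yc n l) g * zz (yc n l) g = Nat.factorial n * (ykap n l * ykap n l) := by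
    rw [← tt_yc_yc n l hn]
    have := sum_class_mul (zz (yc n l)) (zz_conj _) (yc n l)
    simp_rw [zz_inv] at this
    rw [← this, Fintype.card_perm, Fintype.card_fin, tt]
  have h2 := sum_zz_irr n l hn
  have h3 : ∑ g, (irrChar n l g : ℂ) * irrChar n l g = Nat.factorial n := by
    have := irrChar_orth n l l hn hn
    rw [if_pos rfl] at this
    exact_mod_cast this
  have h4 : ∑ g, ((Y g : ℤ) : ℂ) * Y g = 0 := by
    calc ∑ g, ((Y g : ℤ) : ℂ) * Y g = ∑ g, zz (yc n l) g * zz (yc n l) g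
          - 2 * ykap n l * ∑ g, zz (yc n l) g * irrChar n l g
          + ykap n l * ykap n l * ∑ g, (irrChar n l g : ℂ) * irrChar n l g := by
          rw [Finset.mul_sum, Finset.mul_sum, ← Finset.sum_sub_distrib, ← Finset.sum_add_distrib]
          refine Finset.sum_congr rfl fun g _ => ?_
          rw [← hY]
          ring
      _ = 0 := by
          rw [h1, h2, h3]
          ring
  have h5 : ∑ g, Y g * Y g = 0 := by exact_mod_cast h4
  rw [Finset.sum_eq_zero_iff_of_nonneg (fun _ _ => mul_self_nonneg _)] at h5
  have h6 := h5 g (Finset.mem_univ _)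
  have h7 := hY g
  rw [mul_self_eq_zero.mp h6] at h7
  rw [Int.cast_zero] at h7
  exact sub_eq_zero.mp h7

end Characters

end Partition'

namespace Partition'

section Idempotents

set_option linter.unusedSectionVars false

variable (n : ℕ) (l : Partition')

/-- The Young idempotent. -/
noncomputable def ye : GA (Equiv.Perm (Fin n)) := (ykap n l)⁻¹ • yc n l

lemma ye_sq (hn : size l = n) : ye n l * ye n l = ye n l := by
  have := ykap_ne_zero n l hn
  rw [ye, smul_mul_smul_comm, yc_sq n l hn, smul_smul]
  congr 1
  field_simp

lemma ye_sandwich (hn : size l = n) (u : GA (Equiv.Perm (Fin n))) :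
    ∃ r : ℂ, ye n l * u * ye n l = r • ye n l := by
  have := ykap_ne_zero n l hn
  obtain ⟨r, hr⟩ := yc_sandwich n l hn u
  refine ⟨(ykap n l)⁻¹ * r, ?_⟩
  rw [ye, smul_mul_assoc, smul_mul_smul_comm, hr, smul_smul, smul_smul]
  congr 1
  ring

lemma zz_ye (hn : size l = n) (g : Equiv.Perm (Fin n)) : zz (ye n l) g = irrChar n l g := by
  have := ykap_ne_zero n l hn
  rw [ye, zz_smul, zz_yc n l hn]
  field_simp

lemma yc_eq (hn : size l = n) : yc n l = ykap n l • ye n l := by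
  rw [ye, smul_smul, mul_inv_cancel₀ (ykap_ne_zero n l hn), one_smul]

lemma ye_orth (m : Partition') (hl : size l = n) (hm : size m = n) (hlm : l ≠ m)
    (u : GA (Equiv.Perm (Fin n))) : ye n l * u * ye n m = 0 := by
  have h1 : tt (ye n l) (ye n m) = 0 := by
    have := sum_class_mul (zz (ye n l)) (zz_conj _) (ye n m)
    simp_rw [zz_inv, zz_ye n l hl, zz_ye n m hm] at this
    have h2 := irrChar_orth n l m hl hm
    rw [if_neg hlm] at h2
    have h3 : ∑ g, (irrChar n l g : ℂ) * irrChar n m g = 0 := by exact_mod_cast h2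
    rw [h3] at this
    rw [tt]
    simp_rw [zz_ye n l hl]
    refine (mul_eq_zero.mp this).resolve_left ?_
    exact_mod_cast Fintype.card_ne_zero
  rw [tt_eq_finrank _ _ (ye_sq n l hl) (ye_sq n m hm)] at h1
  have h2 : Module.finrank ℂ (LinearMap.range (sandwich (ye n l) (ye n m))) = 0 := by
    exact_mod_cast h1
  rw [Submodule.finrank_eq_zero, LinearMap.range_eq_bot] at h2
  rw [← sandwich_apply, h2, LinearMap.zero_apply]

lemma youngCount_comp (a : Fin n → ℤ) (σ : Equiv.Perm (Fin n)) (g : Equiv.Perm (Fin n)) :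
    youngCount n (fun i => a (σ i)) g = youngCount n a g := by
  rw [youngCount_eq, youngCount_eq]
  refine Eq.trans ?_ (Equiv.sum_comp (Equiv.arrowCongr (Equiv.refl (Fin n)) σ) _)
  refine Finset.sum_congr rfl fun f _ => ?_
  have hfib : ∀ i, fib (Equiv.arrowCongr (Equiv.refl (Fin n)) σ f) (σ i) = fib f i := by
    intro i
    unfold fib
    congr 1
    ext x
    simp
  have key : ((∀ i, (fib f i : ℤ) = a (σ i)) ∧ f ∘ g = f) ↔
      ((∀ i, (fib (Equiv.arrowCongr (Equiv.refl (Fin n)) σ f) i : ℤ) = a i) ∧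
        (Equiv.arrowCongr (Equiv.refl (Fin n)) σ f) ∘ g = Equiv.arrowCongr (Equiv.refl (Fin n)) σ f) := by
    apply and_congr
    · constructor
      · intro h i
        have := h (σ⁻¹ i)
        rw [← hfib] at this
        simpa using this
      · intro h i
        rw [← hfib]
        exact h _
    · simp [funext_iff]
  split_ifs with h5 h6 h6
  · rfl
  · exact absurd (key.mp h5) h6
  · exact absurd (key.mpr h6) h5
  · rfl

lemma youngCount_neg (a : Fin n → ℤ) (g : Equiv.Perm (Fin n)) (h : ¬ ∀ i, 0 ≤ a i) :
    youngCount n a g = 0 := by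
  rw [youngCount, if_neg h]

/-- The sum of group elements weighted by a Young permutation character. -/
noncomputable def ysum (a : Fin n → ℤ) : GA (Equiv.Perm (Fin n)) :=
  ∑ g, (youngCount n a g : ℂ) • gof g

lemma class_sum {G : Type} [Group G] [Fintype G] (u : GA G) :
    ∑ x : G, gof x⁻¹ * u * gof x = ∑ g, zz u g • gof g := by
  ext y
  rw [coeff_sum_gof, MonoidAlgebra.coeff_sum, Finsupp.finsetSum_apply, zz]
  refine Finset.sum_congr rfl fun x _ => ?_
  rw [MonoidAlgebra.coeff_mul_single_apply, MonoidAlgebra.coeff_single_mul_apply]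
  simp [mul_assoc]

lemma exists_partition (a : Fin n → ℕ) (ha : Antitone a) (hs : ∑ i, a i = n) :
    ∃ l : Partition', size l = n ∧ ∀ i : Fin n, l.1 i = a i := by
  let F : ℕ →₀ ℕ := Finsupp.onFinset (Finset.range n) (fun i => if h : i < n then a ⟨i, h⟩ else 0) (by
    intro i hi
    by_contra h
    rw [Finset.mem_range] at h
    simp [h] at hi)
  have hF : ∀ i : Fin n, F i = a i := by
    intro i
    simp [F]
  refine ⟨⟨F, ?_⟩, ?_, hF⟩
  · intro i j hij
    by_cases hj : j < n
    · have hi : i < n := lt_of_le_of_lt hij hj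
      rw [hF ⟨j, hj⟩, hF ⟨i, hi⟩]
      exact ha hij
    · have : F j = 0 := by simp [F, hj]
      rw [this]
      exact Nat.zero_le _
  · change F.sum (fun _ v => v) = n
    rw [Finsupp.sum_of_support_subset F (s := Finset.range n) Finsupp.support_onFinset_subset _ (fun _ _ => rfl)]
    rw [Finset.sum_range]
    simp_rw [hF]
    exact hs

lemma ysum_mem (S : Submodule ℂ (GA (Equiv.Perm (Fin n))))
    (hS : ∀ l, size l = n → ∀ g h, gof g * ye n l * gof h ∈ S) :
    ∀ (N : ℕ) (a : Fin n → ℕ), ∑ i, a i = n → ∑ i : Fin n, (i : ℕ) * a i = N →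
      ysum n (fun i => (a i : ℤ)) ∈ S := by
  intro N
  induction N using Nat.strong_induction_on with
  | _ N ih =>
  intro a hs hN
  by_cases ha : Antitone a
  · obtain ⟨l, hl, hla⟩ := exists_partition n a ha hs
    have h1 : ∑ g, (irrChar n l g : ℂ) • gof g ∈ S := by
      have h2 := class_sum (ye n l)
      simp_rw [zz_ye n l hl] at h2
      rw [← h2]
      exact sum_mem fun x _ => hS l hl _ _
    have h3 : ∑ g, (irrChar n l g : ℂ) • gof g = ∑ σ : Equiv.Perm (Fin n), ((Equiv.Perm.sign σ : ℤ) : ℂ) •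
        ysum n (fun i => (a i : ℤ) + ((σ i : ℕ) : ℤ) - (i : ℤ)) := by
      unfold ysum irrChar
      simp_rw [Finset.smul_sum]
      rw [Finset.sum_comm]
      refine Finset.sum_congr rfl fun g _ => ?_
      push_cast
      rw [Finset.sum_smul]
      refine Finset.sum_congr rfl fun σ _ => ?_
      rw [smul_smul]
      simp_rw [hla]
    rw [← Finset.add_sum_erase _ (fun σ : Equiv.Perm (Fin n) => ((Equiv.Perm.sign σ : ℤ) : ℂ) •
        ysum n (fun i => (a i : ℤ) + ((σ i : ℕ) : ℤ) - (i : ℤ))) (Finset.mem_univ (1 : Equiv.Perm (Fin n)))] at h3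
    have h4 : ((Equiv.Perm.sign (1 : Equiv.Perm (Fin n)) : ℤ) : ℂ) •
        ysum n (fun i => (a i : ℤ) + (((1 : Equiv.Perm (Fin n)) i : ℕ) : ℤ) - (i : ℤ)) =
        ysum n (fun i => (a i : ℤ)) := by
      simp
    rw [h4] at h3
    rw [eq_sub_of_add_eq h3.symm]
    refine sub_mem h1 (sum_mem fun σ hσ => S.smul_mem _ ?_)
    have hσ1 : σ ≠ 1 := (Finset.mem_erase.mp hσ).1
    by_cases hp : ∀ i : Fin n, 0 ≤ (a i : ℤ) + ((σ i : ℕ) : ℤ) - (i : ℤ)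
    · choose b hb using fun i => Int.eq_ofNat_of_zero_le (hp i)
      simp_rw [hb]
      refine ih _ ?_ b ?_ rfl
      · rw [← hN]
        zify
        have h3 : ∑ i : Fin n, ((i : ℕ) : ℤ) * (b i : ℤ) =
            ∑ i : Fin n, ((i : ℕ) : ℤ) * (a i : ℤ) + ∑ i : Fin n, ((i : ℕ) : ℤ) * ((σ i : ℕ) : ℤ) -
            ∑ i : Fin n, ((i : ℕ) : ℤ) * ((i : ℕ) : ℤ) := by
          rw [← Finset.sum_add_distrib, ← Finset.sum_sub_distrib]
          refine Finset.sum_congr rfl fun i _ => ?_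
          rw [← hb i]
          ring
        have := sum_mul_perm_lt n σ hσ1
        omega
      · zify
        simp_rw [← hb]
        rw [Finset.sum_sub_distrib, Finset.sum_add_distrib]
        have : ∑ i : Fin n, ((σ i : ℕ) : ℤ) = ∑ i : Fin n, ((i : ℕ) : ℤ) :=
          Equiv.sum_comp σ (fun i : Fin n => ((i : ℕ) : ℤ))
        rw [this]
        have : ∑ i : Fin n, (a i : ℤ) = n := by exact_mod_cast hs
        rw [this]
        ring
    · have : ysum n (fun i => (a i : ℤ) + ((σ i : ℕ) : ℤ) - (i : ℤ)) = 0 := by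
        unfold ysum
        apply Finset.sum_eq_zero
        intro g _
        rw [youngCount_neg n _ _ hp]
        simp
      rw [this]
      exact S.zero_mem
  · unfold Antitone at ha
    push Not at ha
    obtain ⟨i, j, hij, hlt⟩ := ha
    have hne : i ≠ j := by rintro rfl; exact lt_irrefl _ hlt
    have hij' : i < j := lt_of_le_of_ne hij hne
    have h1 : ysum n (fun t => (a t : ℤ)) = ysum n (fun t => ((a (Equiv.swap i j t) : ℕ) : ℤ)) := by
      unfold ysum
      refine Finset.sum_congr rfl fun g _ => ?_
      rw [youngCount_comp n (fun t => (a t : ℤ)) (Equiv.swap i j) g]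
    rw [h1]
    refine ih _ ?_ (fun t => a (Equiv.swap i j t)) ?_ rfl
    · rw [← hN]
      rw [← Finset.add_sum_erase _ _ (Finset.mem_univ i), ← Finset.add_sum_erase (a := j) _ _ (by simp [hne.symm])]
      rw [← Finset.add_sum_erase Finset.univ (fun t : Fin n => (t : ℕ) * a t) (Finset.mem_univ i), ← Finset.add_sum_erase (a := j) _ (fun t : Fin n => (t : ℕ) * a t) (by simp [hne.symm])]
      rw [Finset.sum_congr rfl (g := fun t : Fin n => (t : ℕ) * a t)]
      · rw [Equiv.swap_apply_left, Equiv.swap_apply_right]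
        have h5 : (i : ℕ) < j := hij'
        have h6 : (i : ℕ) * a j + (j : ℕ) * a i < (i : ℕ) * a i + (j : ℕ) * a j := by nlinarith
        omega
      · intro t ht
        simp only [Finset.mem_erase] at ht
        rw [Equiv.swap_apply_of_ne_of_ne ht.2.1 ht.1]
    · exact (Equiv.sum_comp (Equiv.swap i j) a).trans hs

lemma ye_complete (S : Submodule ℂ (GA (Equiv.Perm (Fin n))))
    (hS : ∀ l, size l = n → ∀ g h, gof g * ye n l * gof h ∈ S) : (1 : GA (Equiv.Perm (Fin n))) ∈ S := by
  have h1 := ysum_mem n S hS _ (fun _ => 1) (by simp) rfl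
  have h0 : ∀ g : Equiv.Perm (Fin n), g ≠ 1 → youngCount n (fun _ => ((1 : ℕ) : ℤ)) g = 0 := by
    intro g hg
    rw [youngCount_eq]
    apply Finset.sum_eq_zero
    intro f _
    rw [if_neg]
    rintro ⟨h2, h3⟩
    apply hg
    have hinj : Function.Injective f := by
      intro s t hst
      have h4 := h2 (f t)
      have h5 : fib f (f t) ≤ 1 := by omega
      unfold fib at h5
      rw [Finset.card_le_one] at h5
      exact h5 s (by simp [hst]) t (by simp)
    ext t
    have := congrFun h3 t
    rw [hinj this]
    rfl
  have h2 : ysum n (fun _ => ((1 : ℕ) : ℤ)) = (youngCount n (fun _ => ((1 : ℕ) : ℤ)) 1 : ℂ) • 1 := by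
    unfold ysum
    rw [Finset.sum_eq_single 1]
    · rfl
    · intro g _ hg
      rw [h0 g hg]
      simp
    · simp
  have h3 : youngCount n (fun _ => ((1 : ℕ) : ℤ)) 1 ≠ 0 := by
    rw [youngCount_eq]
    apply ne_of_gt
    apply Finset.sum_pos'
    · intro f _
      split_ifs <;> norm_num
    · refine ⟨id, Finset.mem_univ _, ?_⟩
      rw [if_pos]
      · norm_num
      · refine ⟨fun i => ?_, rfl⟩
        have : fib (id : Fin n → Fin n) i = 1 := by
          unfold fib
          rw [Finset.card_eq_one]
          refine ⟨i, ?_⟩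
          ext x
          simp
        rw [this]
  have h4 : (youngCount n (fun _ => ((1 : ℕ) : ℤ)) 1 : ℂ) ≠ 0 := by exact_mod_cast h3
  rw [h2] at h1
  exact (S.smul_mem_iff h4).mp h1

end Idempotents

end Partition'

namespace Partition'

section Restriction

set_option linter.unusedSectionVars false

variable {G H : Type} [Group G] [Fintype G] [Group H] [Fintype H] (j : H →* G)

/-- Induced map of group algebras. -/
noncomputable def jA : GA H →ₗ[ℂ] GA G := (MonoidAlgebra.basis H ℂ).constr ℂ (fun h => gof (j h))

lemma jA_gof (h : H) : jA j (gof h) = gof (j h) := by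
  have : gof h = MonoidAlgebra.basis H ℂ h := by simp
  rw [this, jA, Module.Basis.constr_basis]

/-- Bilinear extension principle. -/
lemma ga_induction {M : Type*} [AddCommGroup M] [Module ℂ M] (F F' : GA G →ₗ[ℂ] M)
    (h : ∀ g, F (gof g) = F' (gof g)) (a : GA G) : F a = F' a := by
  rw [ga_eq_sum a, map_sum, map_sum]
  refine Finset.sum_congr rfl fun g _ => ?_
  rw [map_smul, map_smul, h]

lemma jA_mul (a b : GA H) : jA j (a * b) = jA j a * jA j b := by
  refine ga_induction (jA j ∘ₗ LinearMap.mulRight ℂ b) (LinearMap.mulRight ℂ (jA j b) ∘ₗ jA j) (fun g => ?_) a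
  refine ga_induction (jA j ∘ₗ LinearMap.mulLeft ℂ (gof g)) (LinearMap.mulLeft ℂ (jA j (gof g)) ∘ₗ jA j) (fun h => ?_) b
  simp only [LinearMap.comp_apply, LinearMap.mulLeft_apply]
  rw [← gof_mul, jA_gof, jA_gof, jA_gof, map_mul, gof_mul]

lemma jA_one : jA j 1 = 1 := by
  rw [← gof_one, jA_gof, map_one, gof_one]

/-- Restriction of coefficients to the subgroup. -/
noncomputable def rE : GA G →ₗ[ℂ] GA H where
  toFun a := ∑ h, a.coeff (j h) • gof h
  map_add' a b := by
    rw [← Finset.sum_add_distrib]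
    refine Finset.sum_congr rfl fun h _ => ?_
    rw [← add_smul]
    rfl
  map_smul' r a := by
    rw [Finset.smul_sum]
    refine Finset.sum_congr rfl fun h _ => ?_
    rw [MonoidAlgebra.coeff_smul_apply, smul_smul]
    rfl

lemma rE_coeff (a : GA G) (h : H) : (rE j a).coeff h = a.coeff (j h) := by
  change (∑ h, a.coeff (j h) • gof h : GA H).coeff h = _
  rw [coeff_sum_gof (fun h => a.coeff (j h))]

lemma rE_mul (a : GA G) (b : GA H) : rE j (a * jA j b) = rE j a * b := by
  refine ga_induction (rE j ∘ₗ LinearMap.mulLeft ℂ a ∘ₗ jA j) (LinearMap.mulLeft ℂ (rE j a)) (fun g => ?_) b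
  simp only [LinearMap.comp_apply, LinearMap.mulLeft_apply]
  ext x
  rw [jA_gof, rE_coeff, MonoidAlgebra.coeff_mul_single_apply, MonoidAlgebra.coeff_mul_single_apply, rE_coeff]
  simp

lemma mul_rE (a : GA G) (b : GA H) : rE j (jA j b * a) = b * rE j a := by
  refine ga_induction (rE j ∘ₗ LinearMap.mulRight ℂ a ∘ₗ jA j) (LinearMap.mulRight ℂ (rE j a)) (fun g => ?_) b
  simp only [LinearMap.comp_apply, LinearMap.mulRight_apply]
  ext x
  rw [jA_gof, rE_coeff, MonoidAlgebra.coeff_single_mul_apply, MonoidAlgebra.coeff_single_mul_apply, rE_coeff]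
  simp

lemma coeff_one_comm (a b : GA G) : (a * b).coeff 1 = (b * a).coeff 1 := by
  rw [ga_coeff_mul, ga_coeff_mul]
  rw [← Equiv.sum_comp (Equiv.inv G)]
  refine Finset.sum_congr rfl fun g _ => ?_
  simp [mul_comm]

lemma coeff_one_ne_zero (f : GA G) (hf : f * f = f) (h0 : f ≠ 0) : f.coeff 1 ≠ 0 := by
  intro h
  have h1 := tt_one_left f
  rw [h, mul_zero, tt_eq_finrank 1 f (one_mul _) hf] at h1
  have h2 : Module.finrank ℂ (LinearMap.range (sandwich 1 f)) = 0 := by exact_mod_cast h1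
  rw [Submodule.finrank_eq_zero, LinearMap.range_eq_bot] at h2
  have := sandwich_apply 1 f 1
  rw [h2] at this
  simp at this
  exact h0 this.symm

lemma jA_coeff (hj : Function.Injective j) (b : GA H) (h : H) : (jA j b).coeff (j h) = b.coeff h := by
  have := rE_mul j 1 b
  rw [one_mul] at this
  rw [← rE_coeff, this]
  have h1 : rE j (1 : GA G) = 1 := by
    ext x
    rw [rE_coeff, ← gof_one, ← gof_one, MonoidAlgebra.coeff_single, MonoidAlgebra.coeff_single,
      Finsupp.single_apply, Finsupp.single_apply]
    congr 1
    rw [← map_one j]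
    exact propext (hj.eq_iff)
  rw [h1, one_mul]

/-- The dual bases. -/
lemma exists_dual (hj : Function.Injective j) (e : GA G) (f : GA H) (he : e * e = e) (hf : f * f = f)
    (h0 : f ≠ 0) (hs : ∀ b, ∃ r : ℂ, f * b * f = r • f) (d : ℕ) (hd : tt e (jA j f) = d) :
    ∃ u v : Fin d → GA G, (∀ i, e * u i = u i) ∧ (∀ i, u i * jA j f = u i) ∧
      (∀ i, jA j f * v i = v i) ∧ (∀ i, v i * e = v i) ∧
      (∀ i k, rE j (v i * u k) = if i = k then f else 0) ∧
      ∀ a : GA G, e * a * jA j f ∈ Submodule.span ℂ (Set.range u) := by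
  have hjf : jA j f * jA j f = jA j f := by rw [← jA_mul, hf]
  have hc := coeff_one_ne_zero f hf h0
  rw [tt_eq_finrank _ _ he hjf] at hd
  have hd' : Module.finrank ℂ (LinearMap.range (sandwich e (jA j f))) = d := by exact_mod_cast hd
  let B := Module.finBasisOfFinrankEq ℂ (LinearMap.range (sandwich e (jA j f))) hd'
  have hB : ∀ i, e * (B i : GA G) = B i ∧ (B i : GA G) * jA j f = B i := by
    intro i
    obtain ⟨a, ha⟩ := (B i).2
    rw [sandwich_apply] at ha
    rw [← ha]
    constructor
    · rw [← mul_assoc, ← mul_assoc, he]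
    · rw [mul_assoc, hjf]
  have hex : ∀ i, ∃ a : GA G, ∀ k, (a * B k).coeff 1 = if i = k then f.coeff 1 else 0 := by
    intro i
    obtain ⟨φ, hφ⟩ := LinearMap.exists_extend (f.coeff 1 • B.coord i)
    refine ⟨∑ g, φ (gof g) • gof g⁻¹, fun k => ?_⟩
    have h1 : ∀ x : GA G, ((∑ g, φ (gof g) • gof g⁻¹) * x).coeff 1 = φ x := by
      intro x
      conv_rhs => rw [ga_eq_sum x, map_sum]
      rw [Finset.sum_mul, MonoidAlgebra.coeff_sum, Finsupp.finsetSum_apply]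
      refine Finset.sum_congr rfl fun g _ => ?_
      rw [smul_mul_assoc, MonoidAlgebra.coeff_smul_apply, MonoidAlgebra.coeff_single_mul_apply, map_smul]
      simp [mul_comm]
    rw [h1]
    have h2 := LinearMap.congr_fun hφ (B k)
    simp only [LinearMap.comp_apply, Submodule.subtype_apply, LinearMap.smul_apply, Module.Basis.coord_apply,
      Module.Basis.repr_self, Finsupp.single_apply, smul_eq_mul] at h2
    rw [h2]
    by_cases hik : i = k
    · subst hik; simp
    · rw [if_neg hik, if_neg (fun h => hik h.symm), mul_zero]
  choose a ha using hex
  refine ⟨fun i => B i, fun i => jA j f * a i * e, fun i => (hB i).1, fun i => (hB i).2, ?_, ?_, ?_, ?_⟩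
  · intro i
    rw [← mul_assoc, ← mul_assoc, hjf]
  · intro i
    rw [mul_assoc, he]
  · intro i k
    have h1 : jA j f * a i * e * (B k : GA G) = jA j f * (a i * B k) := by
      rw [mul_assoc, (hB k).1, mul_assoc]
    have h2 : a i * (B k : GA G) = a i * B k * jA j f := by rw [mul_assoc, (hB k).2]
    rw [h1, h2, mul_rE, rE_mul, ← mul_assoc]
    obtain ⟨r, hr⟩ := hs (rE j (a i * B k))
    rw [hr]
    have h3 : (f * rE j (a i * (B k : GA G)) * f).coeff 1 = if i = k then f.coeff 1 else 0 := by
      rw [coeff_one_comm, ← mul_assoc, hf, coeff_one_comm, ← rE_mul, ← h2, rE_coeff, map_one, ha]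
    rw [hr, MonoidAlgebra.coeff_smul_apply] at h3
    split_ifs at h3 ⊢ with h
    · have : r = 1 := by
        apply mul_right_cancel₀ hc
        rw [one_mul]
        exact h3
      rw [this, one_smul]
    · have : r = 0 := (mul_eq_zero.mp h3).resolve_right hc
      rw [this, zero_smul]
  · intro x
    have hx : e * x * jA j f ∈ LinearMap.range (sandwich e (jA j f)) := ⟨x, sandwich_apply _ _ _⟩
    have h1 := B.sum_repr ⟨_, hx⟩
    have h2 := congrArg (Submodule.subtype _) h1
    rw [map_sum] at h2
    simp only [map_smul, Submodule.subtype_apply] at h2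
    rw [← h2]
    exact sum_mem fun i _ => Submodule.smul_mem _ _ (Submodule.subset_span ⟨i, rfl⟩)

/-- Resolution of the identity. -/
lemma dual_complete {P : Type} [Fintype P] (d : P → ℕ) (e : GA G) (f : P → GA H)
    (he : e * e = e)
    (hf : ∀ p, f p * f p = f p)
    (ho : ∀ p q, p ≠ q → ∀ b, f p * b * f q = 0)
    (hcomp : ∀ S : Submodule ℂ (GA H), (∀ p g h, gof g * f p * gof h ∈ S) → 1 ∈ S)
    (u v : ∀ p, Fin (d p) → GA G)
    (hu2 : ∀ p i, u p i * jA j (f p) = u p i) (hv1 : ∀ p i, jA j (f p) * v p i = v p i)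
    (huv : ∀ p i k, rE j (v p i * u p k) = if i = k then f p else 0)
    (hspan : ∀ p, ∀ a : GA G, e * a * jA j (f p) ∈ Submodule.span ℂ (Set.range (u p)))
    (a : GA G) (ha : e * a = a) :
    ∑ p, ∑ i, u p i * jA j (rE j (v p i * a)) = a := by
  let T : GA G →ₗ[ℂ] GA G := ∑ p, ∑ i, LinearMap.mulLeft ℂ (u p i) ∘ₗ jA j ∘ₗ rE j ∘ₗ LinearMap.mulLeft ℂ (v p i)
  have hT : ∀ x, T x = ∑ p, ∑ i, u p i * jA j (rE j (v p i * x)) := by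
    intro x
    simp [T, LinearMap.sum_apply]
  have hTm : ∀ x b, T (x * jA j b) = T x * jA j b := by
    intro x b
    rw [hT, hT, Finset.sum_mul]
    refine Finset.sum_congr rfl fun p _ => ?_
    rw [Finset.sum_mul]
    refine Finset.sum_congr rfl fun i _ => ?_
    rw [← mul_assoc, rE_mul, jA_mul, mul_assoc]
  have hTu : ∀ q k, T (u q k) = u q k := by
    intro q k
    rw [hT, Finset.sum_eq_single q, Finset.sum_eq_single k]
    · rw [huv, if_pos rfl, hu2]
    · intro i _ hi
      rw [huv, if_neg hi, map_zero, mul_zero]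
    · simp
    · intro p _ hp
      apply Finset.sum_eq_zero
      intro i _
      have : rE j (v p i * u q k) = 0 := by
        rw [← hv1, ← hu2 q, mul_assoc, mul_rE, ← mul_assoc (v p i), rE_mul, ← mul_assoc, ho p q hp]
      rw [this, map_zero, mul_zero]
    · simp
  have hTs : ∀ q x, T (e * x * jA j (f q)) = e * x * jA j (f q) := by
    intro q x
    have : Submodule.span ℂ (Set.range (u q)) ≤ LinearMap.eqLocus T LinearMap.id := by
      rw [Submodule.span_le]
      rintro _ ⟨k, rfl⟩
      exact hTu q k
    exact this (hspan q x)
  have h1 := hcomp (LinearMap.ker ((T - LinearMap.id) ∘ₗ LinearMap.mulLeft ℂ a ∘ₗ jA j)) (by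
    intro p g h
    rw [LinearMap.mem_ker]
    simp only [LinearMap.comp_apply, LinearMap.mulLeft_apply, LinearMap.sub_apply, LinearMap.id_apply]
    rw [jA_mul, jA_mul, ← mul_assoc, hTm, ← mul_assoc a]
    have h2 := hTs p (a * jA j (gof g))
    rw [← mul_assoc e, ha] at h2
    rw [h2, sub_self])
  rw [LinearMap.mem_ker] at h1
  simp only [LinearMap.comp_apply, LinearMap.mulLeft_apply, LinearMap.sub_apply, LinearMap.id_apply, jA_one,
    mul_one] at h1
  rw [← hT]
  exact sub_eq_zero.mp h1

end Restriction

end Partition'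

namespace Partition'

section Pairs

set_option linter.unusedSectionVars false

variable {G K : Type} [Group G] [Fintype G] [Group K] [Fintype K]

/-- External product in the group algebra of a product. -/
noncomputable def pr (a : GA G) (b : GA K) : GA (G × K) :=
  jA (MonoidHom.inl G K) a * jA (MonoidHom.inr G K) b

lemma pr_gof (g : G) (h : K) : pr (gof g) (gof h) = gof (g, h) := by
  rw [pr, jA_gof, jA_gof, ← gof_mul]
  simp

/-- `pr` as a linear map in the first variable. -/
noncomputable def prL (b : GA K) : GA G →ₗ[ℂ] GA (G × K) :=
  LinearMap.mulRight ℂ (jA (MonoidHom.inr G K) b) ∘ₗ jA (MonoidHom.inl G K)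

/-- `pr` as a linear map in the second variable. -/
noncomputable def prR (a : GA G) : GA K →ₗ[ℂ] GA (G × K) :=
  LinearMap.mulLeft ℂ (jA (MonoidHom.inl G K) a) ∘ₗ jA (MonoidHom.inr G K)

lemma prL_apply (a : GA G) (b : GA K) : prL b a = pr a b := rfl
lemma prR_apply (a : GA G) (b : GA K) : prR a b = pr a b := rfl

lemma pr_comm (a : GA G) (b : GA K) :
    jA (MonoidHom.inr G K) b * jA (MonoidHom.inl G K) a = pr a b := by
  refine ga_induction (LinearMap.mulLeft ℂ (jA (MonoidHom.inr G K) b) ∘ₗ jA (MonoidHom.inl G K)) (prL b)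
    (fun g => ?_) a
  refine ga_induction (LinearMap.mulRight ℂ (jA (MonoidHom.inl G K) (gof g)) ∘ₗ jA (MonoidHom.inr G K)) (prR (gof g))
    (fun h => ?_) b
  simp only [LinearMap.comp_apply, LinearMap.mulRight_apply]
  rw [prR_apply, pr_gof, jA_gof, jA_gof, ← gof_mul]
  simp

lemma pr_mul (a a' : GA G) (b b' : GA K) : pr a b * pr a' b' = pr (a * a') (b * b') := by
  have := pr_comm a' b
  unfold pr at *
  rw [jA_mul, jA_mul, mul_assoc, ← mul_assoc _ _ (jA (MonoidHom.inr G K) b'), this]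
  simp only [mul_assoc]

lemma pr_one : pr (1 : GA G) (1 : GA K) = 1 := by
  rw [pr, jA_one, jA_one, mul_one]

lemma pr_smul (r s : ℂ) (a : GA G) (b : GA K) : pr (r • a) (s • b) = (r * s) • pr a b := by
  rw [pr, map_smul, map_smul, smul_mul_smul_comm]
  rfl

lemma pr_coeff (a : GA G) (b : GA K) (x : G × K) : (pr a b).coeff x = a.coeff x.1 * b.coeff x.2 := by
  have h1 : pr a b = ∑ g : G, ∑ h : K, (a.coeff g * b.coeff h) • gof (g, h) := by
    conv_lhs => rw [ga_eq_sum a, ga_eq_sum b]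
    rw [← prL_apply, map_sum]
    refine Finset.sum_congr rfl fun g _ => ?_
    rw [prL_apply, ← prR_apply, map_sum]
    refine Finset.sum_congr rfl fun h _ => ?_
    rw [prR_apply, pr_smul, pr_gof]
  rw [h1, ← Fintype.sum_prod_type' (f := fun g h => (a.coeff g * b.coeff h) • gof (g, h))]
  exact coeff_sum_gof (fun x : G × K => a.coeff x.1 * b.coeff x.2) x

lemma zz_pr (a : GA G) (b : GA K) (x : G × K) : zz (pr a b) x = zz a x.1 * zz b x.2 := by
  unfold zz
  simp_rw [pr_coeff]
  rw [Fintype.sum_prod_type, Finset.sum_mul_sum]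
  rfl

lemma tt_jA (j : K →* G) (e : GA G) (f : GA K) : tt e (jA j f) = ∑ h, zz e (j h) * f.coeff h⁻¹ := by
  let F : GA K →ₗ[ℂ] ℂ := ∑ y : G, (zz e y) • ((Finsupp.lapply y⁻¹ : (G →₀ ℂ) →ₗ[ℂ] ℂ) ∘ₗ (MonoidAlgebra.basis G ℂ).repr.toLinearMap ∘ₗ jA j)
  let F' : GA K →ₗ[ℂ] ℂ := ∑ h : K, (zz e (j h)) • ((Finsupp.lapply h⁻¹ : (K →₀ ℂ) →ₗ[ℂ] ℂ) ∘ₗ (MonoidAlgebra.basis K ℂ).repr.toLinearMap)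
  have hF : ∀ f, F f = ∑ y, zz e y * (jA j f).coeff y⁻¹ := by
    intro f
    simp only [F, LinearMap.sum_apply]
    rfl
  have hF' : ∀ f : GA K, F' f = ∑ h, zz e (j h) * f.coeff h⁻¹ := by
    intro f
    simp only [F', LinearMap.sum_apply]
    rfl
  rw [tt, ← hF, ← hF']
  refine ga_induction F F' (fun h => ?_) f
  rw [hF, hF', Finset.sum_eq_single (j h)⁻¹, Finset.sum_eq_single h⁻¹]
  · rw [jA_gof, map_inv j h]
    simp
  · intro x _ hx
    rw [MonoidAlgebra.coeff_single, Finsupp.single_apply, if_neg, mul_zero]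
    rintro rfl
    simp at hx
  · simp
  · intro x _ hx
    rw [jA_gof, MonoidAlgebra.coeff_single, Finsupp.single_apply, if_neg, mul_zero]
    intro hh
    rw [hh] at hx
    simp at hx
  · simp

/-- The embedding of index sets. -/
def emb (k m n : ℕ) (h : k + m = n) : Fin k ⊕ Fin m ≃ Fin n := finSumFinEquiv.trans (finCongr h)

/-- The Young subgroup embedding. -/
def jj (k m n : ℕ) (h : k + m = n) : Equiv.Perm (Fin k) × Equiv.Perm (Fin m) →* Equiv.Perm (Fin n) where
  toFun p := (Equiv.permCongr (emb k m n h)) (Equiv.sumCongr p.1 p.2)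
  map_one' := by
    ext t
    simp [Equiv.permCongr_apply]
  map_mul' p q := by
    ext t
    rw [Equiv.Perm.mul_apply, Equiv.permCongr_apply, Equiv.permCongr_apply, Equiv.permCongr_apply,
      Equiv.symm_apply_apply]
    rcases (emb k m n h).symm t with s | s <;> rfl

lemma jj_apply (k m n : ℕ) (h : k + m = n) (p) (t) :
    jj k m n h p (emb k m n h t) = emb k m n h (Equiv.sumCongr p.1 p.2 t) := by
  change (Equiv.permCongr (emb k m n h)) (Equiv.sumCongr p.1 p.2) _ = _
  rw [Equiv.permCongr_apply, Equiv.symm_apply_apply]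

lemma jj_inj (k m n : ℕ) (h : k + m = n) : Function.Injective (jj k m n h) := by
  intro p q hpq
  have h1 : ∀ t, Equiv.sumCongr p.1 p.2 t = Equiv.sumCongr q.1 q.2 t := by
    intro t
    apply (emb k m n h).injective
    rw [← jj_apply, ← jj_apply, hpq]
  apply Prod.ext
  · ext t
    have := h1 (Sum.inl t)
    simp only [Equiv.sumCongr_apply, Sum.map_inl] at this
    rw [Sum.inl.inj this]
  · ext t
    have := h1 (Sum.inr t)
    simp only [Equiv.sumCongr_apply, Sum.map_inr] at this
    rw [Sum.inr.inj this]

lemma jj_rfl (k m : ℕ) (p) : jj k m (k + m) rfl p = sumEmb p.1 p.2 := rfl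

/-- The idempotent for a pair of partitions. -/
noncomputable def yp (k m : ℕ) (l mu : Partition') : GA (Equiv.Perm (Fin k) × Equiv.Perm (Fin m)) :=
  pr (ye k l) (ye m mu)

variable (k m : ℕ) (l mu : Partition')

lemma yp_sq (hl : size l = k) (hm : size mu = m) : yp k m l mu * yp k m l mu = yp k m l mu := by
  rw [yp, pr_mul, ye_sq k l hl, ye_sq m mu hm]

lemma yp_ne_zero (hl : size l = k) (hm : size mu = m) : yp k m l mu ≠ 0 := by
  intro h
  have h1 : (yp k m l mu).coeff 1 = 0 := by rw [h]; rfl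
  rw [yp, pr_coeff, ye, ye, MonoidAlgebra.coeff_smul_apply, MonoidAlgebra.coeff_smul_apply] at h1
  rw [show (1 : Equiv.Perm (Fin k) × Equiv.Perm (Fin m)).1 = 1 from rfl,
    show (1 : Equiv.Perm (Fin k) × Equiv.Perm (Fin m)).2 = 1 from rfl, yc_coeff_one k l hl, yc_coeff_one m mu hm] at h1
  simp [ykap_ne_zero k l hl, ykap_ne_zero m mu hm] at h1

lemma yp_sandwich (hl : size l = k) (hm : size mu = m) (b) :
    ∃ r : ℂ, yp k m l mu * b * yp k m l mu = r • yp k m l mu := by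
  have h1 : ∀ g, ∃ r : ℂ, yp k m l mu * gof g * yp k m l mu = r • yp k m l mu := by
    rintro ⟨g, h⟩
    obtain ⟨r, hr⟩ := ye_sandwich k l hl (gof g)
    obtain ⟨s, hs⟩ := ye_sandwich m mu hm (gof h)
    refine ⟨r * s, ?_⟩
    rw [← pr_gof, yp, pr_mul, pr_mul, hr, hs, pr_smul]
  choose φ hφ using h1
  refine ⟨∑ g, b.coeff g * φ g, ?_⟩
  conv_lhs => rw [ga_eq_sum b]
  rw [Finset.mul_sum, Finset.sum_mul, Finset.sum_smul]
  refine Finset.sum_congr rfl fun g _ => ?_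
  rw [mul_smul_comm, smul_mul_assoc, hφ, smul_smul]

lemma yp_orth (l' mu' : Partition') (hl : size l = k) (hm : size mu = m) (hl' : size l' = k) (hm' : size mu' = m)
    (hne : (l, mu) ≠ (l', mu')) (b) : yp k m l mu * b * yp k m l' mu' = 0 := by
  rw [ga_eq_sum b, Finset.mul_sum, Finset.sum_mul]
  apply Finset.sum_eq_zero
  rintro ⟨g, h⟩ _
  rw [mul_smul_comm, smul_mul_assoc, ← pr_gof, yp, yp, pr_mul, pr_mul]
  by_cases h1 : l = l'
  · have h2 : mu ≠ mu' := by
      rintro rfl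
      exact hne (by rw [h1])
    rw [ye_orth m mu mu' hm hm' h2, ← prR_apply, map_zero, smul_zero]
  · rw [ye_orth k l l' hl hl' h1, ← prL_apply, map_zero, smul_zero]

lemma yp_complete (S : Submodule ℂ (GA (Equiv.Perm (Fin k) × Equiv.Perm (Fin m))))
    (hS : ∀ l mu, size l = k → size mu = m → ∀ g h, gof g * yp k m l mu * gof h ∈ S) : 1 ∈ S := by
  rw [← pr_one, ← prL_apply]
  change (1 : GA (Equiv.Perm (Fin k))) ∈ S.comap (prL 1)
  apply ye_complete
  intro l hl g h
  rw [Submodule.mem_comap, prL_apply, ← prR_apply]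
  change (1 : GA (Equiv.Perm (Fin m))) ∈ S.comap (prR _)
  apply ye_complete
  intro mu hm g' h'
  rw [Submodule.mem_comap, prR_apply]
  have := hS l mu hl hm (g, g') (h, h')
  rwa [← pr_gof, ← pr_gof, yp, pr_mul, pr_mul] at this

lemma tt_eq_lr (nu : Partition') (hsz : size l + size mu = size nu) :
    tt (ye (size nu) nu) (jA (jj (size l) (size mu) (size nu) hsz) (yp (size l) (size mu) l mu)) = lr l mu nu := by
  generalize hn : size nu = n at hsz
  subst hsz
  set j := jj (size l) (size mu) (size l + size mu) rfl with hj
  have hid : jA j (yp (size l) (size mu) l mu) * jA j (yp (size l) (size mu) l mu) = jA j (yp (size l) (size mu) l mu) := by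
    rw [← jA_mul, yp_sq _ _ _ _ rfl rfl]
  have h1 := tt_eq_finrank _ _ (ye_sq _ nu hn) hid
  generalize Module.finrank ℂ (LinearMap.range (sandwich (ye (size l + size mu) nu) (jA j (yp (size l) (size mu) l mu)))) = d at h1
  have h2 := sum_class_mul (fun x => zz (ye (size l + size mu) nu) (j x)) (fun x y => by
    rw [map_mul, map_mul, map_inv, zz_conj]) (yp (size l) (size mu) l mu)
  rw [← tt_jA, h1] at h2
  have h3 : ∑ h, zz (ye (size l + size mu) nu) (j h) * zz (yp (size l) (size mu) l mu) h⁻¹ =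
      ((∑ g : Equiv.Perm (Fin (size l)), ∑ h : Equiv.Perm (Fin (size mu)),
        irrChar (size l) l g * irrChar (size mu) mu h *
          irrChar (size l + size mu) nu (sumEmb g h) : ℤ) : ℂ) := by
    rw [Fintype.sum_prod_type]
    push_cast
    refine Finset.sum_congr rfl fun g _ => Finset.sum_congr rfl fun h _ => ?_
    rw [yp, zz_pr, zz_ye _ nu hn, Prod.inv_mk, zz_inv, zz_inv, zz_ye _ l rfl, zz_ye _ mu rfl, hj, jj_rfl]
    ring
  rw [h3] at h2
  have h4 : (∑ g : Equiv.Perm (Fin (size l)), ∑ h : Equiv.Perm (Fin (size mu)),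
        irrChar (size l) l g * irrChar (size mu) mu h *
          irrChar (size l + size mu) nu (sumEmb g h) : ℤ) =
        ((Nat.factorial (size l) : ℤ) * (Nat.factorial (size mu) : ℤ)) * d := by
    have h5 : (Fintype.card (Equiv.Perm (Fin (size l)) × Equiv.Perm (Fin (size mu))) : ℤ) =
        (Nat.factorial (size l) : ℤ) * (Nat.factorial (size mu) : ℤ) := by
      rw [Fintype.card_prod, Fintype.card_perm, Fintype.card_perm, Fintype.card_fin, Fintype.card_fin]
      push_cast
      rfl
    rw [← h5]
    exact_mod_cast h2.symm
  rw [h1, lr, if_pos hn, h4, Int.mul_ediv_cancel_left]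
  · simp
  · positivity

lemma lr_size (nu : Partition') (i : Fin (lr l mu nu)) : size l + size mu = size nu := by
  by_contra h
  have h1 : lr l mu nu = 0 := by
    rw [lr, if_neg (fun h' => h h'.symm)]
  rw [h1] at i
  exact i.elim0

instance finite_le (n : ℕ) : Finite {l : Partition' // size l ≤ n} := by
  apply Finite.of_injective (β := Fin n → Fin (n + 1))
    (fun l i => ⟨l.1.1 i, by
      have h1 : l.1.1 (i : ℕ) ≤ size l.1 := by
        by_cases h : (i : ℕ) < size l.1
        · rw [← sum_range_eq_size]
          exact Finset.single_le_sum (f := fun t => l.1.1 t) (fun _ _ => Nat.zero_le _) (Finset.mem_range.mpr h)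
        · rw [eq_zero_of_size_le l.1 _ (not_lt.mp h)]
          exact Nat.zero_le _
      have := l.2
      omega⟩)
  intro a b hab
  apply Subtype.ext
  apply Subtype.ext
  ext r
  by_cases h : r < n
  · have := congrArg Fin.val (congrFun hab ⟨r, h⟩)
    exact this
  · have ha := a.2
    have hb := b.2
    rw [eq_zero_of_size_le a.1 _ (by omega), eq_zero_of_size_le b.1 _ (by omega)]

instance finite_index (nu : Partition') : Finite ((p : Partition' × Partition') × Fin (lr p.1 p.2 nu)) := by
  have h : ∀ i : ((p : Partition' × Partition') × Fin (lr p.1 p.2 nu)), size i.1.1 ≤ size nu ∧ size i.1.2 ≤ size nu := by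
    intro i
    have := lr_size _ _ _ i.2
    omega
  apply Finite.of_injective (β := (p : {l : Partition' // size l ≤ size nu} × {l : Partition' // size l ≤ size nu}) ×
    Fin (lr p.1.1 p.2.1 nu)) (fun i => ⟨(⟨i.1.1, (h i).1⟩, ⟨i.1.2, (h i).2⟩), i.2⟩)
  rintro ⟨⟨a, b⟩, i⟩ ⟨⟨c, d⟩, i'⟩ hh
  simp only [Sigma.mk.injEq, Prod.mk.injEq, Subtype.mk.injEq] at hh
  obtain ⟨⟨rfl, rfl⟩, h2⟩ := hh
  rw [heq_eq_eq] at h2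
  rw [h2]

end Pairs

end Partition'

namespace Partition'

section DualFamily

set_option linter.unusedSectionVars false

/-- The dual basis property. -/
structure UV (nu l mu : Partition') (k m : ℕ) (h : k + m = size nu)
    (u v : Fin (lr l mu nu) → GA (Equiv.Perm (Fin (size nu)))) : Prop where
  eu : ∀ i, ye (size nu) nu * u i = u i
  uf : ∀ i, u i * jA (jj k m _ h) (yp k m l mu) = u i
  fv : ∀ i, jA (jj k m _ h) (yp k m l mu) * v i = v i
  ve : ∀ i, v i * ye (size nu) nu = v i
  dual : ∀ i i', rE (jj k m _ h) (v i * u i') = if i = i' then yp k m l mu else 0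
  span : ∀ a, ye (size nu) nu * a * jA (jj k m _ h) (yp k m l mu) ∈ Submodule.span ℂ (Set.range u)

lemma exists_uv (nu l mu : Partition') : ∃ u v : Fin (lr l mu nu) → GA (Equiv.Perm (Fin (size nu))),
    ∀ k m h, size l = k → size mu = m → UV nu l mu k m h u v := by
  by_cases hsz : size l + size mu = size nu
  · obtain ⟨u, v, h1, h2, h3, h4, h5, h6⟩ := exists_dual (jj (size l) (size mu) (size nu) hsz)
      (jj_inj _ _ _ _) (ye (size nu) nu) (yp (size l) (size mu) l mu) (ye_sq _ nu rfl) (yp_sq _ _ _ _ rfl rfl)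
      (yp_ne_zero _ _ _ _ rfl rfl) (yp_sandwich _ _ _ _ rfl rfl) (lr l mu nu) (tt_eq_lr l mu nu hsz)
    refine ⟨u, v, ?_⟩
    intro k m h hk hm
    subst hk
    subst hm
    exact ⟨h1, h2, h3, h4, h5, h6⟩
  · refine ⟨fun _ => 0, fun _ => 0, ?_⟩
    intro k m h hk hm
    exact absurd (by rw [hk, hm, h]) hsz

/-- Left part of the dual family. -/
noncomputable def uu (nu : Partition') (p : Partition' × Partition') :
    Fin (lr p.1 p.2 nu) → GA (Equiv.Perm (Fin (size nu))) := (exists_uv nu p.1 p.2).choose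

/-- Right part of the dual family. -/
noncomputable def vv (nu : Partition') (p : Partition' × Partition') :
    Fin (lr p.1 p.2 nu) → GA (Equiv.Perm (Fin (size nu))) := (exists_uv nu p.1 p.2).choose_spec.choose

lemma uv_spec (nu : Partition') (p : Partition' × Partition') (k m : ℕ) (h : k + m = size nu)
    (hk : size p.1 = k) (hm : size p.2 = m) : UV nu p.1 p.2 k m h (uu nu p) (vv nu p) :=
  (exists_uv nu p.1 p.2).choose_spec.choose_spec k m h hk hm

lemma uv_orth (nu : Partition') (k m : ℕ) (h : k + m = size nu)
    (x y : (p : Partition' × Partition') × Fin (lr p.1 p.2 nu))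
    (hxk : size x.1.1 = k) (hxm : size x.1.2 = m) (hyk : size y.1.1 = k) (hym : size y.1.2 = m)
    (hxy : x ≠ y) : rE (jj k m _ h) (vv nu x.1 x.2 * uu nu y.1 y.2) = 0 := by
  obtain ⟨p, i⟩ := x
  obtain ⟨q, i'⟩ := y
  have h1 := uv_spec nu p k m h hxk hxm
  have h2 := uv_spec nu q k m h hyk hym
  by_cases hpq : p = q
  · subst hpq
    rw [h1.dual, if_neg]
    rintro rfl
    exact hxy rfl
  · rw [← h1.fv, ← h2.uf, mul_assoc, mul_rE, ← mul_assoc (vv nu _ _), rE_mul, ← mul_assoc]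
    exact yp_orth k m _ _ _ _ hxk hxm hyk hym hpq _

lemma uv_complete (nu : Partition') (k m : ℕ) (h : k + m = size nu) [Fintype ((p : Partition' × Partition') × Fin (lr p.1 p.2 nu))]
    (a : GA (Equiv.Perm (Fin (size nu)))) (ha : ye (size nu) nu * a = a) :
    ∑ x : (p : Partition' × Partition') × Fin (lr p.1 p.2 nu),
      (if size x.1.1 = k ∧ size x.1.2 = m then
        uu nu x.1 x.2 * jA (jj k m _ h) (rE (jj k m _ h) (vv nu x.1 x.2 * a)) else 0) = a := by
  let P := {p : Partition' × Partition' // size p.1 = k ∧ size p.2 = m}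
  have hfin : Finite P := by
    apply Finite.of_injective (β := {l : Partition' // size l ≤ size nu} × {l : Partition' // size l ≤ size nu})
      (fun p => (⟨p.1.1, by have := p.2.1; omega⟩, ⟨p.1.2, by have := p.2.2; omega⟩))
    intro a b hab
    simp only [Prod.mk.injEq, Subtype.mk.injEq] at hab
    exact Subtype.ext (Prod.ext hab.1 hab.2)
  have := Fintype.ofFinite P
  have h1 := dual_complete (jj k m _ h) (P := P) (fun p => lr p.1.1 p.1.2 nu) (ye (size nu) nu)
    (fun p => yp k m p.1.1 p.1.2) (ye_sq _ nu rfl) (fun p => yp_sq k m _ _ p.2.1 p.2.2)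
    (fun p q hpq b => yp_orth k m _ _ _ _ p.2.1 p.2.2 q.2.1 q.2.2 (fun hh => hpq (Subtype.ext hh)) b)
    (fun S hS => yp_complete k m S (fun l mu hl hm g h => hS ⟨(l, mu), hl, hm⟩ g h))
    (fun p => uu nu p.1) (fun p => vv nu p.1)
    (fun p => (uv_spec nu p.1 k m h p.2.1 p.2.2).uf)
    (fun p => (uv_spec nu p.1 k m h p.2.1 p.2.2).fv)
    (fun p => (uv_spec nu p.1 k m h p.2.1 p.2.2).dual)
    (fun p => (uv_spec nu p.1 k m h p.2.1 p.2.2).span) a ha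
  conv_rhs => rw [← h1]
  rw [← Finset.sum_filter]
  symm
  rw [Finset.sum_sigma']
  apply Finset.sum_bij (fun (x : (p : P) × Fin (lr p.1.1 p.1.2 nu)) _ => (⟨x.1.1, x.2⟩ : (p : Partition' × Partition') × Fin (lr p.1 p.2 nu)))
  · rintro ⟨p, i⟩ _
    simpa using p.2
  · rintro ⟨p, i⟩ _ ⟨q, i'⟩ _ hh
    simp only [Sigma.mk.injEq] at hh
    obtain ⟨h2, h3⟩ := hh
    have h4 := Subtype.ext h2
    subst h4
    rw [heq_eq_eq] at h3
    rw [h3]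
  · rintro ⟨p, i⟩ hp
    rw [Finset.mem_filter] at hp
    exact ⟨⟨⟨p, hp.2⟩, i⟩, by simp, rfl⟩
  · rintro ⟨p, i⟩ _
    rfl

end DualFamily

end Partition'

namespace Partition'

section Tensor

set_option linter.unusedSectionVars false

/-- Extension principle, unbundled. -/
lemma ga_ext' {G : Type} [Group G] [Fintype G] {M : Type*} [AddCommGroup M] [Module ℂ M] (F F' : GA G → M)
    (h1 : ∀ a b, F (a + b) = F a + F b) (h2 : ∀ (r : ℂ) a, F (r • a) = r • F a)
    (h1' : ∀ a b, F' (a + b) = F' a + F' b) (h2' : ∀ (r : ℂ) a, F' (r • a) = r • F' a)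
    (h : ∀ g, F (gof g) = F' (gof g)) (a : GA G) : F a = F' a :=
  ga_induction (M := M) ⟨⟨F, h1⟩, h2⟩ ⟨⟨F', h1'⟩, h2'⟩ h a

/-- Tensor powers. -/
abbrev Tp (n : ℕ) (V : Type) [AddCommGroup V] [Module ℂ V] := PiTensorProduct ℂ (fun _ : Fin n => V)

variable (n : ℕ) (V : Type) [AddCommGroup V] [Module ℂ V]

lemma permAction_tprod (σ : Equiv.Perm (Fin n)) (f : Fin n → V) :
    permAction ℂ n V σ (PiTensorProduct.tprod ℂ f) = PiTensorProduct.tprod ℂ (fun t => f (σ⁻¹ t)) := by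
  rw [permAction, LinearEquiv.coe_coe, PiTensorProduct.reindex_tprod]
  rfl

/-- The permutation action as a monoid homomorphism. -/
noncomputable def permHom : Equiv.Perm (Fin n) →* Module.End ℂ (Tp n V) where
  toFun σ := permAction ℂ n V σ
  map_one' := by
    apply PiTensorProduct.ext
    ext f
    simp only [LinearMap.compMultilinearMap_apply]
    rw [permAction_tprod]
    rfl
  map_mul' σ τ := by
    apply PiTensorProduct.ext
    ext f
    simp only [LinearMap.compMultilinearMap_apply, Module.End.mul_apply]
    rw [permAction_tprod, permAction_tprod, permAction_tprod]
    rfl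

/-- The action of the group algebra. -/
noncomputable def rho : GA (Equiv.Perm (Fin n)) →ₐ[ℂ] Module.End ℂ (Tp n V) :=
  MonoidAlgebra.lift ℂ _ _ (permHom n V)

lemma rho_gof (σ : Equiv.Perm (Fin n)) : rho n V (gof σ) = permAction ℂ n V σ := by
  rw [rho, MonoidAlgebra.lift_single, one_smul]
  rfl

lemma filter_eq' {α : Type*} [Fintype α] (p q : α → Prop) (ip : DecidablePred p) (iq : DecidablePred q)
    (h : ∀ a, p a ↔ q a) : @Finset.filter _ p ip Finset.univ = @Finset.filter _ q iq Finset.univ := by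
  ext a
  simp [h]

lemma youngSymmetrizer_eq (l : Partition') : youngSymmetrizer ℂ l V = rho (size l) V (yc (size l) l) := by
  rw [yc, map_mul, sgnSum, stabSum, map_sum, map_sum, youngSymmetrizer, Module.End.mul_eq_comp]
  congr 1
  · refine Finset.sum_congr ?_ fun σ _ => ?_
    · exact filter_eq' _ _ _ _ fun _ => Iff.rfl
    · rw [map_smul, rho_gof]
  · refine Finset.sum_congr ?_ fun σ _ => ?_
    · exact filter_eq' _ _ _ _ fun _ => Iff.rfl
    · rw [rho_gof]

variable {V} {W : Type} [AddCommGroup W] [Module ℂ W]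

/-- Functoriality of tensor powers. -/
noncomputable def tmap (g : V →ₗ[ℂ] W) : Tp n V →ₗ[ℂ] Tp n W := PiTensorProduct.map (fun _ => g)

lemma tmap_tprod (g : V →ₗ[ℂ] W) (f : Fin n → V) :
    tmap n g (PiTensorProduct.tprod ℂ f) = PiTensorProduct.tprod ℂ (fun t => g (f t)) := by
  rw [tmap, PiTensorProduct.map_tprod]

lemma tmap_comp_rho (g : V →ₗ[ℂ] W) (a : GA (Equiv.Perm (Fin n))) :
    tmap n g ∘ₗ rho n V a = rho n W a ∘ₗ tmap n g := by
  refine ga_induction (LinearMap.compRight ℂ (tmap n g) ∘ₗ (rho n V).toLinearMap)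
    (LinearMap.lcomp ℂ (Tp n W) (tmap n g) ∘ₗ (rho n W).toLinearMap) (fun σ => ?_) a
  change tmap n g ∘ₗ rho n V (gof σ) = rho n W (gof σ) ∘ₗ tmap n g
  rw [rho_gof, rho_gof]
  apply PiTensorProduct.ext
  ext f
  simp only [LinearMap.compMultilinearMap_apply, LinearMap.comp_apply]
  rw [tmap_tprod, permAction_tprod, permAction_tprod, tmap_tprod]

variable (V W) (k m : ℕ) (h : k + m = n)

/-- The inclusion of the mixed tensor power. -/
noncomputable def iota : Tp k V ⊗[ℂ] Tp m W →ₗ[ℂ] Tp n (V × W) :=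
  (PiTensorProduct.reindex ℂ (fun _ : Fin k ⊕ Fin m => V × W) (emb k m n h)).toLinearMap ∘ₗ
    (PiTensorProduct.tmulEquiv ℂ (V × W)).toLinearMap ∘ₗ
      TensorProduct.map (tmap k (LinearMap.inl ℂ V W)) (tmap m (LinearMap.inr ℂ V W))

/-- The projection to the mixed tensor power. -/
noncomputable def proj : Tp n (V × W) →ₗ[ℂ] Tp k V ⊗[ℂ] Tp m W :=
  TensorProduct.map (tmap k (LinearMap.fst ℂ V W)) (tmap m (LinearMap.snd ℂ V W)) ∘ₗ
    (PiTensorProduct.tmulEquiv ℂ (V × W)).symm.toLinearMap ∘ₗ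
      (PiTensorProduct.reindex ℂ (fun _ : Fin n => V × W) (emb k m n h).symm).toLinearMap

lemma iota_tprod (a : Fin k → V) (b : Fin m → W) :
    iota n V W k m h (PiTensorProduct.tprod ℂ a ⊗ₜ PiTensorProduct.tprod ℂ b) =
      PiTensorProduct.tprod ℂ (fun t => Sum.elim (fun i => (a i, (0 : W))) (fun i => ((0 : V), b i))
        ((emb k m n h).symm t)) := by
  simp only [iota, LinearMap.comp_apply, TensorProduct.map_tmul, tmap_tprod, LinearEquiv.coe_coe]
  rw [PiTensorProduct.tmulEquiv_apply, PiTensorProduct.reindex_tprod]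
  rfl

lemma proj_tprod (c : Fin n → V × W) :
    proj n V W k m h (PiTensorProduct.tprod ℂ c) =
      PiTensorProduct.tprod ℂ (fun i => (c (emb k m n h (Sum.inl i))).1) ⊗ₜ
      PiTensorProduct.tprod ℂ (fun i => (c (emb k m n h (Sum.inr i))).2) := by
  simp only [proj, LinearMap.comp_apply, LinearEquiv.coe_coe]
  rw [PiTensorProduct.reindex_tprod, PiTensorProduct.tmulEquiv_symm_apply, TensorProduct.map_tmul,
    tmap_tprod, tmap_tprod]
  rfl

lemma mixed_ext {M : Type*} [AddCommGroup M] [Module ℂ M] (X Y : Tp k V ⊗[ℂ] Tp m W →ₗ[ℂ] M)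
    (hXY : ∀ a b, X (PiTensorProduct.tprod ℂ a ⊗ₜ PiTensorProduct.tprod ℂ b) =
      Y (PiTensorProduct.tprod ℂ a ⊗ₜ PiTensorProduct.tprod ℂ b)) : X = Y := by
  apply TensorProduct.ext
  apply PiTensorProduct.ext
  ext a : 1
  simp only [LinearMap.compMultilinearMap_apply]
  apply PiTensorProduct.ext
  ext b : 1
  exact hXY a b

/-- The action of the Young subgroup. -/
noncomputable def actHom : Equiv.Perm (Fin k) × Equiv.Perm (Fin m) →* Module.End ℂ (Tp k V ⊗[ℂ] Tp m W) where
  toFun p := TensorProduct.map (permHom k V p.1) (permHom m W p.2)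
  map_one' := by
    rw [Prod.fst_one, Prod.snd_one, map_one, map_one]
    exact TensorProduct.map_id
  map_mul' p q := by
    rw [Prod.fst_mul, Prod.snd_mul, map_mul, map_mul]
    exact TensorProduct.map_comp _ _ _ _

/-- The action of the group algebra of the Young subgroup. -/
noncomputable def act : GA (Equiv.Perm (Fin k) × Equiv.Perm (Fin m)) →ₐ[ℂ] Module.End ℂ (Tp k V ⊗[ℂ] Tp m W) :=
  MonoidAlgebra.lift ℂ _ _ (actHom V W k m)

lemma act_gof (p) : act V W k m (gof p) = TensorProduct.map (permAction ℂ k V p.1) (permAction ℂ m W p.2) := by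
  rw [act, MonoidAlgebra.lift_single, one_smul]
  rfl

lemma act_pr (a : GA (Equiv.Perm (Fin k))) (b : GA (Equiv.Perm (Fin m))) :
    act V W k m (pr a b) = TensorProduct.map (rho k V a) (rho m W b) := by
  refine ga_ext' (fun a => act V W k m (pr a b)) (fun a => TensorProduct.map (rho k V a) (rho m W b))
    (fun x y => by rw [show pr (x + y) b = pr x b + pr y b from map_add (prL b) x y, map_add])
    (fun r x => by rw [show pr (r • x) b = r • pr x b from map_smul (prL b) r x, map_smul])
    (fun x y => by rw [map_add]; exact TensorProduct.map_add_left _ _ _)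
    (fun r x => by rw [map_smul]; exact TensorProduct.map_smul_left _ _ _)
    (fun g => ?_) a
  refine ga_ext' (fun b => act V W k m (pr (gof g) b)) (fun b => TensorProduct.map (rho k V (gof g)) (rho m W b))
    (fun x y => by rw [show pr (gof g) (x + y) = pr (gof g) x + pr (gof g) y from map_add (prR (gof g)) x y, map_add])
    (fun r x => by rw [show pr (gof g) (r • x) = r • pr (gof g) x from map_smul (prR (gof g)) r x, map_smul])
    (fun x y => by rw [map_add]; exact TensorProduct.map_add_right _ _ _)
    (fun r x => by rw [map_smul]; exact TensorProduct.map_smul_right _ _ _)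
    (fun h => ?_) b
  change act V W k m (pr (gof g) (gof h)) = TensorProduct.map (rho k V (gof g)) (rho m W (gof h))
  rw [pr_gof, act_gof, rho_gof, rho_gof]

lemma iota_act (b : GA (Equiv.Perm (Fin k) × Equiv.Perm (Fin m))) :
    iota n V W k m h ∘ₗ act V W k m b = rho n (V × W) (jA (jj k m n h) b) ∘ₗ iota n V W k m h := by
  refine ga_ext' (fun b => iota n V W k m h ∘ₗ act V W k m b)
    (fun b => rho n (V × W) (jA (jj k m n h) b) ∘ₗ iota n V W k m h)
    (fun x y => by rw [map_add]; exact LinearMap.comp_add _ _ _)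
    (fun r x => by rw [map_smul]; exact LinearMap.comp_smul _ _ _)
    (fun x y => by rw [map_add, map_add]; exact LinearMap.add_comp _ _ _)
    (fun r x => by rw [map_smul, map_smul]; exact LinearMap.smul_comp _ _ _) (fun p => ?_) b
  change iota n V W k m h ∘ₗ act V W k m (gof p) = rho n (V × W) (jA (jj k m n h) (gof p)) ∘ₗ iota n V W k m h
  rw [jA_gof, rho_gof, act_gof]
  apply mixed_ext
  intro a b
  simp only [LinearMap.comp_apply, TensorProduct.map_tmul, permAction_tprod, iota_tprod]
  congr 1
  funext t
  obtain ⟨s, rfl⟩ := (emb k m n h).surjective t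
  rw [← map_inv, jj_apply, Equiv.symm_apply_apply, Equiv.symm_apply_apply]
  rcases s with s | s <;> rfl

lemma proj_iota_zero (k' m' : ℕ) (h' : k' + m' = n) (g : Equiv.Perm (Fin n))
    (hg : (∃ i i', (emb k m n h).symm (g⁻¹ (emb k' m' n h' (Sum.inl i))) = Sum.inr i') ∨
      (∃ i i', (emb k m n h).symm (g⁻¹ (emb k' m' n h' (Sum.inr i))) = Sum.inl i')) :
    proj n V W k' m' h' ∘ₗ rho n (V × W) (gof g) ∘ₗ iota n V W k m h = 0 := by
  apply mixed_ext
  intro a b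
  simp only [LinearMap.comp_apply, rho_gof, iota_tprod, permAction_tprod, proj_tprod, LinearMap.zero_apply]
  rcases hg with ⟨i, i', hi⟩ | ⟨i, i', hi⟩
  · rw [MultilinearMap.map_coord_zero (PiTensorProduct.tprod ℂ) i, TensorProduct.zero_tmul]
    rw [hi]
    rfl
  · rw [MultilinearMap.map_coord_zero (PiTensorProduct.tprod ℂ) (m := fun i => (Sum.elim (fun i => (a i, (0 : W))) (fun i => ((0 : V), b i))
        ((emb k m n h).symm (g⁻¹ (emb k' m' n h' (Sum.inr i))))).2) i, TensorProduct.tmul_zero]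
    rw [hi]
    rfl

lemma proj_rho_iota (a : GA (Equiv.Perm (Fin n))) :
    proj n V W k m h ∘ₗ rho n (V × W) a ∘ₗ iota n V W k m h = act V W k m (rE (jj k m n h) a) := by
  refine ga_ext' (fun a => proj n V W k m h ∘ₗ rho n (V × W) a ∘ₗ iota n V W k m h)
    (fun a => act V W k m (rE (jj k m n h) a))
    (fun x y => by rw [map_add]; exact (congrArg _ (LinearMap.add_comp _ _ _)).trans (LinearMap.comp_add _ _ _))
    (fun r x => by rw [map_smul]; exact (congrArg _ (LinearMap.smul_comp _ _ _)).trans (LinearMap.comp_smul _ _ _))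
    (fun x y => by rw [map_add, map_add])
    (fun r x => by rw [map_smul, map_smul]) (fun g => ?_) a
  change proj n V W k m h ∘ₗ rho n (V × W) (gof g) ∘ₗ iota n V W k m h = act V W k m (rE (jj k m n h) (gof g))
  by_cases hg : ∃ p, jj k m n h p = g
  · obtain ⟨p, rfl⟩ := hg
    have h1 : rE (jj k m n h) (gof (jj k m n h p)) = gof p := by
      ext x
      rw [rE_coeff, MonoidAlgebra.coeff_single, MonoidAlgebra.coeff_single,
        Finsupp.single_apply, Finsupp.single_apply]
      congr 1
      exact propext (jj_inj k m n h).eq_iff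
    rw [h1, act_gof, rho_gof]
    apply mixed_ext
    intro a b
    simp only [LinearMap.comp_apply, TensorProduct.map_tmul, permAction_tprod, iota_tprod, proj_tprod]
    simp_rw [← map_inv, jj_apply, Equiv.symm_apply_apply]
    rfl
  · have h1 : rE (jj k m n h) (gof g) = 0 := by
      ext x
      rw [rE_coeff, MonoidAlgebra.coeff_single, Finsupp.single_apply, if_neg]
      · rfl
      · rintro rfl
        exact hg ⟨x, rfl⟩
    rw [h1, map_zero]
    apply proj_iota_zero
    left
    by_contra hc
    push Not at hc
    apply hg
    have h2 := Equiv.Perm.mem_sumCongrHom_range_of_perm_mapsTo_inl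
      (σ := ((emb k m n h).trans (g⁻¹ : Equiv.Perm (Fin n))).trans (emb k m n h).symm) (by
        rintro _ ⟨i, rfl⟩
        rcases hh : (emb k m n h).symm (g⁻¹ (emb k m n h (Sum.inl i))) with s | s
        · exact ⟨s, hh.symm⟩
        · exact absurd hh (hc i s))
    obtain ⟨p, hp⟩ := h2
    refine ⟨p⁻¹, ?_⟩
    rw [map_inv, inv_eq_iff_eq_inv]
    ext1 t
    obtain ⟨s, rfl⟩ := (emb k m n h).surjective t
    rw [jj_apply]
    have h3 := Equiv.congr_fun hp s
    change Equiv.sumCongr p.1 p.2 s = (emb k m n h).symm (g⁻¹ (emb k m n h s)) at h3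
    rw [h3, Equiv.apply_symm_apply]

lemma proj_rho_iota_ne (k' m' : ℕ) (h' : k' + m' = n) (hne : k' ≠ k) (a : GA (Equiv.Perm (Fin n))) :
    proj n V W k' m' h' ∘ₗ rho n (V × W) a ∘ₗ iota n V W k m h = 0 := by
  refine ga_ext' (fun a => proj n V W k' m' h' ∘ₗ rho n (V × W) a ∘ₗ iota n V W k m h)
    (fun a => 0)
    (fun x y => by rw [map_add]; exact (congrArg _ (LinearMap.add_comp _ _ _)).trans (LinearMap.comp_add _ _ _))
    (fun r x => by rw [map_smul]; exact (congrArg _ (LinearMap.smul_comp _ _ _)).trans (LinearMap.comp_smul _ _ _))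
    (fun x y => (add_zero _).symm)
    (fun r x => (smul_zero _).symm) (fun g => ?_) a
  change proj n V W k' m' h' ∘ₗ rho n (V × W) (gof g) ∘ₗ iota n V W k m h = 0
  apply proj_iota_zero
  by_contra hc
  push Not at hc
  obtain ⟨h1, h2⟩ := hc
  set π : Fin k' ⊕ Fin m' ≃ Fin k ⊕ Fin m := ((emb k' m' n h').trans (g⁻¹ : Equiv.Perm (Fin n))).trans (emb k m n h).symm
    with hπ
  have e1 : ∀ i, ∃ s, π (Sum.inl i) = Sum.inl s := by
    intro i
    rcases hh : π (Sum.inl i) with s | s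
    · exact ⟨s, rfl⟩
    · exact absurd hh (h1 i s)
  have e2 : ∀ i, ∃ s, π (Sum.inr i) = Sum.inr s := by
    intro i
    rcases hh : π (Sum.inr i) with s | s
    · exact absurd hh (h2 i s)
    · exact ⟨s, rfl⟩
  choose f1 hf1 using e1
  choose f2 hf2 using e2
  have c1 : k' ≤ k := by
    have : Function.Injective f1 := by
      intro x y hxy
      have := π.injective ((hf1 x).trans ((congrArg Sum.inl hxy).trans (hf1 y).symm))
      exact Sum.inl.inj this
    simpa using Fintype.card_le_of_injective f1 this
  have c2 : m' ≤ m := by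
    have : Function.Injective f2 := by
      intro x y hxy
      have := π.injective ((hf2 x).trans ((congrArg Sum.inr hxy).trans (hf2 y).symm))
      exact Sum.inr.inj this
    simpa using Fintype.card_le_of_injective f2 this
  omega

/-- Mixed tensors span. -/
lemma big_ext {M : Type*} [AddCommGroup M] [Module ℂ M] (X Y : Tp n (V × W) →ₗ[ℂ] M)
    (hXY : ∀ k m h g w, X (rho n (V × W) (gof g) (iota n V W k m h w)) =
      Y (rho n (V × W) (gof g) (iota n V W k m h w))) : X = Y := by
  apply PiTensorProduct.ext
  ext c
  simp only [LinearMap.compMultilinearMap_apply]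
  have hc : c = (fun t => ((c t).1, (0 : W))) + fun t => ((0 : V), (c t).2) := by
    funext t
    simp
  rw [hc, MultilinearMap.map_add_univ, map_sum, map_sum]
  refine Finset.sum_congr rfl fun s _ => ?_
  have hk : s.card + sᶜ.card = n := by simpa using Finset.card_add_card_compl s
  have h1 : PiTensorProduct.tprod ℂ (s.piecewise (fun t => ((c t).1, (0 : W))) fun t => ((0 : V), (c t).2)) =
      rho n (V × W) (gof ((emb s.card sᶜ.card n hk).symm.trans (finSumEquivOfFinset rfl rfl))) (iota n V W s.card sᶜ.card hk
        (PiTensorProduct.tprod ℂ (fun i => (c (finSumEquivOfFinset (s := s) rfl rfl (Sum.inl i))).1) ⊗ₜ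
          PiTensorProduct.tprod ℂ (fun i => (c (finSumEquivOfFinset (s := s) rfl rfl (Sum.inr i))).2))) := by
    rw [iota_tprod, rho_gof, permAction_tprod]
    congr 1
    funext t
    obtain ⟨x, rfl⟩ := (finSumEquivOfFinset (s := s) rfl rfl).surjective t
    have h2 : (emb s.card sᶜ.card n hk).symm (((emb s.card sᶜ.card n hk).symm.trans (finSumEquivOfFinset rfl rfl) : Equiv.Perm (Fin n))⁻¹
      (finSumEquivOfFinset (s := s) rfl rfl x)) = x := by
      rw [Equiv.symm_apply_eq, Equiv.Perm.inv_eq_iff_eq]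
      simp
    rw [h2]
    rcases x with x | x
    · rw [Finset.piecewise_eq_of_mem]
      · rfl
      · simp
    · rw [Finset.piecewise_eq_of_notMem]
      · rfl
      · rw [finSumEquivOfFinset_inr, ← Finset.mem_compl]
        simp
  rw [h1]
  exact hXY _ _ _ _ _

/-- Naturality of `proj`. -/
lemma proj_nat (g₁ : V →ₗ[ℂ] V) (g₂ : W →ₗ[ℂ] W) :
    proj n V W k m h ∘ₗ tmap n (LinearMap.prodMap g₁ g₂) =
      TensorProduct.map (tmap k g₁) (tmap m g₂) ∘ₗ proj n V W k m h := by
  apply PiTensorProduct.ext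
  ext c
  simp only [LinearMap.compMultilinearMap_apply, LinearMap.comp_apply, tmap_tprod, proj_tprod, TensorProduct.map_tmul]
  rfl

end Tensor

end Partition'

namespace Partition'

section Final

set_option linter.unusedSectionVars false

variable (V : Type) [AddCommGroup V] [Module ℂ V]

lemma rho_mul_apply (n : ℕ) (a b : GA (Equiv.Perm (Fin n))) (x : Tp n V) :
    rho n V (a * b) x = rho n V a (rho n V b x) := by
  rw [map_mul]
  rfl

lemma mem_schur_iff (l : Partition') (x : Tp (size l) V) :
    x ∈ schur ℂ l V ↔ rho (size l) V (ye (size l) l) x = x := by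
  rw [schur, LinearMap.mem_range]
  constructor
  · rintro ⟨y, rfl⟩
    rw [youngSymmetrizer_eq, yc_eq _ _ rfl, map_smul, LinearMap.smul_apply, map_smul, ← rho_mul_apply, ye_sq _ _ rfl]
  · intro hx
    refine ⟨(ykap (size l) l)⁻¹ • x, ?_⟩
    rw [youngSymmetrizer_eq, yc_eq _ _ rfl, map_smul, map_smul, LinearMap.smul_apply, hx, smul_smul,
      inv_mul_cancel₀ (ykap_ne_zero _ l rfl), one_smul]

lemma rho_mem_schur (l : Partition') (a : GA (Equiv.Perm (Fin (size l)))) (ha : ye (size l) l * a = a)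
    (x : Tp (size l) V) : rho (size l) V a x ∈ schur ℂ l V := by
  rw [mem_schur_iff, ← rho_mul_apply, ha]

/-- The projection onto the Schur module. -/
noncomputable def sL (l : Partition') : Tp (size l) V →ₗ[ℂ] schur ℂ l V :=
  LinearMap.codRestrict (schur ℂ l V) (rho (size l) V (ye (size l) l)) (rho_mem_schur V l _ (ye_sq _ _ rfl))

lemma sL_sub (l : Partition') : sL V l ∘ₗ (schur ℂ l V).subtype = LinearMap.id := by
  refine LinearMap.ext fun x => ?_
  exact Subtype.ext ((mem_schur_iff V l x.1).1 x.2)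

lemma sub_sL (l : Partition') : (schur ℂ l V).subtype ∘ₗ sL V l = rho (size l) V (ye (size l) l) := by
  refine LinearMap.ext fun x => ?_
  rfl

lemma sL_rho (l : Partition') : sL V l ∘ₗ rho (size l) V (ye (size l) l) = sL V l := by
  rw [← sub_sL, ← LinearMap.comp_assoc, sL_sub, LinearMap.id_comp]

variable {V} in
lemma tmap_mem (l : Partition') (g : V →ₗ[ℂ] V) : ∀ x ∈ schur ℂ l V, tpow ℂ (size l) g x ∈ schur ℂ l V := by
  intro x hx
  rw [mem_schur_iff] at hx ⊢
  change rho (size l) V _ (tmap (size l) g x) = tmap (size l) g x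
  have := LinearMap.congr_fun (tmap_comp_rho (size l) g (ye (size l) l)) x
  rw [LinearMap.comp_apply, LinearMap.comp_apply, hx] at this
  exact this.symm

variable {V} in
lemma sL_nat (l : Partition') (g : V →ₗ[ℂ] V) (hg) :
    sL V l ∘ₗ tmap (size l) g = (tpow ℂ (size l) g).restrict hg ∘ₗ sL V l := by
  refine LinearMap.ext fun x => ?_
  apply Subtype.ext
  exact (LinearMap.congr_fun (tmap_comp_rho (size l) g (ye (size l) l)) x).symm

variable (W : Type) [AddCommGroup W] [Module ℂ W] (nu : Partition')

/-- The index type. -/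
abbrev Ix (nu : Partition') := (p : Partition' × Partition') × Fin (lr p.1 p.2 nu)

lemma ixh (i : Ix nu) : size i.1.1 + size i.1.2 = size nu := lr_size _ _ _ i.2

lemma ixs (i : Ix nu) : UV nu i.1.1 i.1.2 (size i.1.1) (size i.1.2) (ixh nu i) (uu nu i.1) (vv nu i.1) :=
  uv_spec nu i.1 _ _ _ rfl rfl

/-- Iota for an index. -/
noncomputable abbrev io (i : Ix nu) := iota (size nu) V W (size i.1.1) (size i.1.2) (ixh nu i)

/-- Proj for an index. -/
noncomputable abbrev pj (i : Ix nu) := proj (size nu) V W (size i.1.1) (size i.1.2) (ixh nu i)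

/-- Component of the forward map. -/
noncomputable def Fi (i : Ix nu) : schur ℂ nu (V × W) →ₗ[ℂ] (schur ℂ i.1.1 V) ⊗[ℂ] (schur ℂ i.1.2 W) :=
  TensorProduct.map (sL V i.1.1) (sL W i.1.2) ∘ₗ pj V W nu i ∘ₗ rho (size nu) (V × W) (vv nu i.1 i.2) ∘ₗ
    (schur ℂ nu (V × W)).subtype

/-- Component of the backward map. -/
noncomputable def Gi (i : Ix nu) : (schur ℂ i.1.1 V) ⊗[ℂ] (schur ℂ i.1.2 W) →ₗ[ℂ] schur ℂ nu (V × W) :=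
  LinearMap.codRestrict (schur ℂ nu (V × W))
    (rho (size nu) (V × W) (uu nu i.1 i.2) ∘ₗ io V W nu i ∘ₗ
      TensorProduct.map (schur ℂ i.1.1 V).subtype (schur ℂ i.1.2 W).subtype)
    (fun _ => rho_mem_schur _ nu _ ((ixs nu i).eu i.2) _)

lemma pru_zero (n k m k' m' : ℕ) (h : k + m = n) (h' : k' + m' = n) (a : GA (Equiv.Perm (Fin n)))
    (hE : k' = k → m' = m → rE (jj k m n h) a = 0) :
    proj n V W k' m' h' ∘ₗ rho n (V × W) a ∘ₗ iota n V W k m h = 0 := by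
  by_cases hk : k' = k
  · have hm : m' = m := by omega
    have h1 := hE hk hm
    subst hk
    subst hm
    rw [proj_rho_iota, h1, map_zero]
  · exact proj_rho_iota_ne n V W k m h k' m' h' hk a

lemma Fi_Gi_ne (i q : Ix nu) (hiq : i ≠ q) : Fi V W nu i ∘ₗ Gi V W nu q = 0 := by
  have h1 : pj V W nu i ∘ₗ rho (size nu) (V × W) (vv nu i.1 i.2 * uu nu q.1 q.2) ∘ₗ io V W nu q = 0 := by
    apply pru_zero
    intro hk hm
    exact uv_orth nu _ _ _ i q hk hm rfl rfl hiq
  refine LinearMap.ext fun w => ?_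
  have h2 := LinearMap.congr_fun h1 (TensorProduct.map (schur ℂ q.1.1 V).subtype (schur ℂ q.1.2 W).subtype w)
  rw [LinearMap.comp_apply, LinearMap.comp_apply, rho_mul_apply] at h2
  exact (congrArg _ h2).trans (map_zero _)

lemma Fi_Gi_eq (i : Ix nu) : Fi V W nu i ∘ₗ Gi V W nu i = LinearMap.id := by
  have h1 : pj V W nu i ∘ₗ rho (size nu) (V × W) (vv nu i.1 i.2 * uu nu i.1 i.2) ∘ₗ io V W nu i =
      TensorProduct.map (rho _ V (ye _ i.1.1)) (rho _ W (ye _ i.1.2)) := by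
    rw [proj_rho_iota, (ixs nu i).dual, if_pos rfl, yp, act_pr]
  have h3 : TensorProduct.map (sL V i.1.1) (sL W i.1.2) ∘ₗ
      TensorProduct.map (rho _ V (ye _ i.1.1)) (rho _ W (ye _ i.1.2)) ∘ₗ
      TensorProduct.map (schur ℂ i.1.1 V).subtype (schur ℂ i.1.2 W).subtype = LinearMap.id := by
    rw [← TensorProduct.map_comp, ← TensorProduct.map_comp, ← LinearMap.comp_assoc, ← LinearMap.comp_assoc,
      sL_rho, sL_rho, sL_sub, sL_sub, TensorProduct.map_id]
  refine LinearMap.ext fun w => ?_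
  have h2 := LinearMap.congr_fun h1 (TensorProduct.map (schur ℂ i.1.1 V).subtype (schur ℂ i.1.2 W).subtype w)
  rw [LinearMap.comp_apply, LinearMap.comp_apply, rho_mul_apply] at h2
  exact (congrArg _ h2).trans (LinearMap.congr_fun h3 w)

lemma Gi_Fi (i : Ix nu) (x : schur ℂ nu (V × W)) : (Gi V W nu i (Fi V W nu i x) : Tp (size nu) (V × W)) =
    rho (size nu) (V × W) (uu nu i.1 i.2) (io V W nu i (pj V W nu i (rho (size nu) (V × W) (vv nu i.1 i.2) x.1))) := by
  have h1 : TensorProduct.map (schur ℂ i.1.1 V).subtype (schur ℂ i.1.2 W).subtype ∘ₗ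
      TensorProduct.map (sL V i.1.1) (sL W i.1.2) = act V W _ _ (yp (size i.1.1) (size i.1.2) i.1.1 i.1.2) := by
    rw [← TensorProduct.map_comp, sub_sL, sub_sL, yp, act_pr]
  have h2 := LinearMap.congr_fun h1 (pj V W nu i (rho (size nu) (V × W) (vv nu i.1 i.2) x.1))
  have h3 := LinearMap.congr_fun (iota_act (size nu) V W _ _ (ixh nu i) (yp (size i.1.1) (size i.1.2) i.1.1 i.1.2))
    (pj V W nu i (rho (size nu) (V × W) (vv nu i.1 i.2) x.1))
  refine (congrArg (fun z => rho (size nu) (V × W) (uu nu i.1 i.2) (io V W nu i z)) h2).trans ?_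
  refine (congrArg (fun z => rho (size nu) (V × W) (uu nu i.1 i.2) z) h3).trans ?_
  rw [LinearMap.comp_apply, ← rho_mul_apply, (ixs nu i).uf]

lemma ipr (n k m k' m' : ℕ) (h : k + m = n) (h' : k' + m' = n) (a : GA (Equiv.Perm (Fin n)))
    (w : Tp k V ⊗[ℂ] Tp m W) :
    iota n V W k' m' h' (proj n V W k' m' h' (rho n (V × W) a (iota n V W k m h w))) =
      rho n (V × W) (if k' = k ∧ m' = m then jA (jj k m n h) (rE (jj k m n h) a) else 0) (iota n V W k m h w) := by
  split_ifs with hkm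
  · obtain ⟨hk, hm⟩ := hkm
    subst hk
    subst hm
    have h1 := LinearMap.congr_fun (proj_rho_iota n V W k' m' h a) w
    have h2 := LinearMap.congr_fun (iota_act n V W k' m' h (rE (jj k' m' n h) a)) w
    exact (congrArg _ h1).trans h2
  · have h1 := LinearMap.congr_fun (proj_rho_iota_ne n V W k m h k' m' h' (fun hk => hkm ⟨hk, by omega⟩) a) w
    rw [map_zero]
    exact (congrArg _ h1).trans (map_zero _)

lemma sum_GF [Fintype (Ix nu)] (x : schur ℂ nu (V × W)) : ∑ i, Gi V W nu i (Fi V W nu i x) = x := by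
  have key : (∑ i, rho (size nu) (V × W) (uu nu i.1 i.2) ∘ₗ io V W nu i ∘ₗ pj V W nu i ∘ₗ
      rho (size nu) (V × W) (vv nu i.1 i.2)) ∘ₗ rho (size nu) (V × W) (ye (size nu) nu) =
      rho (size nu) (V × W) (ye (size nu) nu) := by
    apply big_ext
    intro k m h g w
    have ha : ye (size nu) nu * (ye (size nu) nu * gof g) = ye (size nu) nu * gof g := by
      rw [← mul_assoc, ye_sq _ _ rfl]
    rw [LinearMap.comp_apply, ← rho_mul_apply, LinearMap.sum_apply]
    conv_rhs => rw [← uv_complete nu k m h _ ha, map_sum, LinearMap.sum_apply]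
    refine Finset.sum_congr rfl fun i _ => ?_
    simp only [LinearMap.comp_apply]
    rw [← rho_mul_apply, ipr, ← rho_mul_apply, mul_ite, mul_zero]
  apply Subtype.ext
  have hx := (mem_schur_iff _ nu x.1).1 x.2
  have h1 := LinearMap.congr_fun key x.1
  rw [LinearMap.comp_apply, hx, LinearMap.sum_apply] at h1
  rw [AddSubmonoidClass.coe_finsetSum]
  refine Eq.trans ?_ h1
  refine Finset.sum_congr rfl fun i _ => ?_
  exact Gi_Fi V W nu i x

/-- The target. -/
abbrev Dt := ⨁ (i : Ix nu), ((schur ℂ i.1.1 V) ⊗[ℂ] (schur ℂ i.1.2 W))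

/-- Forward map. -/
noncomputable def Ff [Fintype (Ix nu)] : schur ℂ nu (V × W) →ₗ[ℂ] Dt V W nu :=
  ∑ i, DirectSum.lof ℂ (Ix nu) (fun i => (schur ℂ i.1.1 V) ⊗[ℂ] (schur ℂ i.1.2 W)) i ∘ₗ Fi V W nu i

/-- Backward map. -/
noncomputable def Gg : Dt V W nu →ₗ[ℂ] schur ℂ nu (V × W) :=
  DirectSum.toModule ℂ (Ix nu) _ (fun i => Gi V W nu i)

lemma Gg_Ff [Fintype (Ix nu)] : Gg V W nu ∘ₗ Ff V W nu = LinearMap.id := by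
  refine LinearMap.ext fun x => ?_
  rw [LinearMap.comp_apply, Ff, LinearMap.sum_apply, map_sum]
  refine Eq.trans (Finset.sum_congr rfl fun i _ => ?_) (sum_GF V W nu x)
  rw [LinearMap.comp_apply, Gg, DirectSum.toModule_lof]

lemma Ff_Gg [Fintype (Ix nu)] : Ff V W nu ∘ₗ Gg V W nu = LinearMap.id := by
  apply DirectSum.linearMap_ext
  intro q
  refine LinearMap.ext fun w => ?_
  rw [LinearMap.comp_apply, LinearMap.comp_apply, Gg, DirectSum.toModule_lof, Ff, LinearMap.sum_apply,
    Finset.sum_eq_single q]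
  · rw [LinearMap.comp_apply, ← LinearMap.comp_apply (Fi V W nu q), Fi_Gi_eq]
    rfl
  · intro i _ hi
    rw [LinearMap.comp_apply, ← LinearMap.comp_apply (Fi V W nu i), Fi_Gi_ne V W nu i q hi, LinearMap.zero_apply, map_zero]
  · intro h
    exact absurd (Finset.mem_univ _) h

variable {V W} in
lemma Fi_nat (g₁ : V →ₗ[ℂ] V) (g₂ : W →ₗ[ℂ] W) (i : Ix nu) (h h₁ h₂) (x : schur ℂ nu (V × W)) :
    Fi V W nu i ((tpow ℂ (size nu) (LinearMap.prodMap g₁ g₂)).restrict h x) =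
      TensorProduct.map ((tpow ℂ (size i.1.1) g₁).restrict h₁) ((tpow ℂ (size i.1.2) g₂).restrict h₂)
        (Fi V W nu i x) := by
  have e1 := LinearMap.congr_fun (tmap_comp_rho (size nu) (LinearMap.prodMap g₁ g₂) (vv nu i.1 i.2)) x.1
  have e2 := LinearMap.congr_fun (proj_nat (size nu) V W _ _ (ixh nu i) g₁ g₂) (rho (size nu) (V × W) (vv nu i.1 i.2) x.1)
  have e3 : TensorProduct.map (sL V i.1.1) (sL W i.1.2) ∘ₗ TensorProduct.map (tmap _ g₁) (tmap _ g₂) =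
      TensorProduct.map ((tpow ℂ (size i.1.1) g₁).restrict h₁) ((tpow ℂ (size i.1.2) g₂).restrict h₂) ∘ₗ
      TensorProduct.map (sL V i.1.1) (sL W i.1.2) := by
    rw [← TensorProduct.map_comp, ← TensorProduct.map_comp, sL_nat, sL_nat]
  have e4 := LinearMap.congr_fun e3 (pj V W nu i (rho (size nu) (V × W) (vv nu i.1 i.2) x.1))
  refine Eq.trans ?_ e4
  refine Eq.trans ?_ (congrArg (TensorProduct.map (sL V i.1.1) (sL W i.1.2)) e2)
  exact congrArg (fun z => TensorProduct.map (sL V i.1.1) (sL W i.1.2) (pj V W nu i z)) e1.symm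

end Final

end Partition'

open Partition' in
/-- for finite dimensional complex vector spaces `V₁, V₂` and a partition `ν`
of length at most `dim V₁ + dim V₂`, the Schur module `S^ν(V₁ ⊕ V₂)` — invariant under the
componentwise action of `GL(V₁) × GL(V₂)` — decomposes `GL(V₁) × GL(V₂)`-equivariantly as
`⊕_{λ,μ} (S^λ V₁ ⊗ S^μ V₂)^{⊕ c_{λ,μ}^ν}`, where `c` are the Littlewood–Richardson
coefficients. -/
theorem schurModule_directSum_decomposition (V₁ V₂ : Type) [AddCommGroup V₁] [Module ℂ V₁]
    [AddCommGroup V₂] [Module ℂ V₂] [FiniteDimensional ℂ V₁] [FiniteDimensional ℂ V₂]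
    (nu : Partition')
    (hlen : plength nu ≤ Module.finrank ℂ V₁ + Module.finrank ℂ V₂) :
    ∃ (hinv : ∀ (g₁ : V₁ ≃ₗ[ℂ] V₁) (g₂ : V₂ ≃ₗ[ℂ] V₂),
        ∀ x ∈ schur ℂ nu (V₁ × V₂),
          tpow ℂ (size nu) (LinearMap.prodMap g₁.toLinearMap g₂.toLinearMap) x ∈
            schur ℂ nu (V₁ × V₂))
      (hinv₁ : ∀ (l : Partition') (g₁ : V₁ ≃ₗ[ℂ] V₁),
        ∀ x ∈ schur ℂ l V₁, tpow ℂ (size l) g₁.toLinearMap x ∈ schur ℂ l V₁)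
      (hinv₂ : ∀ (m : Partition') (g₂ : V₂ ≃ₗ[ℂ] V₂),
        ∀ x ∈ schur ℂ m V₂, tpow ℂ (size m) g₂.toLinearMap x ∈ schur ℂ m V₂)
      (e : schur ℂ nu (V₁ × V₂) ≃ₗ[ℂ]
        ⨁ (i : ((p : Partition' × Partition') × Fin (lr p.1 p.2 nu))),
          ((schur ℂ i.1.1 V₁) ⊗[ℂ] (schur ℂ i.1.2 V₂))),
      ∀ (g₁ : V₁ ≃ₗ[ℂ] V₁) (g₂ : V₂ ≃ₗ[ℂ] V₂),
        e.toLinearMap ∘ₗ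
            (tpow ℂ (size nu) (LinearMap.prodMap g₁.toLinearMap g₂.toLinearMap)).restrict
              (hinv g₁ g₂) =
          (DirectSum.toModule ℂ _ _ fun i =>
            (DirectSum.lof ℂ _
                (fun i : ((p : Partition' × Partition') × Fin (lr p.1 p.2 nu)) =>
                  ((schur ℂ i.1.1 V₁) ⊗[ℂ] (schur ℂ i.1.2 V₂))) i) ∘ₗ
              TensorProduct.map
                ((tpow ℂ (size i.1.1) g₁.toLinearMap).restrict (hinv₁ i.1.1 g₁))
                ((tpow ℂ (size i.1.2) g₂.toLinearMap).restrict (hinv₂ i.1.2 g₂))) ∘ₗ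
            e.toLinearMap := by
  have hft : Fintype (Ix nu) := Fintype.ofFinite _
  refine ⟨fun g₁ g₂ => tmap_mem nu _, fun l g₁ => tmap_mem l _, fun l g₂ => tmap_mem l _,
    LinearEquiv.ofLinear (Ff V₁ V₂ nu) (Gg V₁ V₂ nu) (Ff_Gg V₁ V₂ nu) (Gg_Ff V₁ V₂ nu), ?_⟩
  intro g₁ g₂
  refine LinearMap.ext fun x => ?_
  change Ff V₁ V₂ nu _ = DirectSum.toModule ℂ _ _ _ (Ff V₁ V₂ nu x)
  rw [Ff, LinearMap.sum_apply, LinearMap.sum_apply, map_sum]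
  refine Finset.sum_congr rfl fun i _ => ?_
  rw [LinearMap.comp_apply, LinearMap.comp_apply, DirectSum.toModule_lof, LinearMap.comp_apply,
    Fi_nat nu g₁.toLinearMap g₂.toLinearMap i]
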